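/- arXiv:2408.09684 — 7 statements merged into one kernel-verified Lean document; each statement's English description precedes it below -/
import Mathlib

section
/- Let G = (V,E) be a finite oriented graph that is dipath oriented, and let (h_v)_{v∈V} be a Hamiltonian compatible with G. Then the independent set charges pairwise commute: Q_G^{(i)} · Q_G^{(j)} = Q_G^{(j)} · Q_G^{(i)} for all 0 ≤ i, j ≤ α(G). -/
noncomputable section
open scoped Classical

/-- `ω = exp(2πi/d)`, the primitive `d`-th root of unity. -/
def omegaD (d : ℕ) : ℂ := Complex.exp (2 * Real.pi * Complex.I / d)

/-- A finite set of vertices is independent if its elements are pairwise non-adjacent. -/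
def IsIndep {V : Type*} (G : SimpleGraph V) (S : Finset V) : Prop :=
  ∀ u ∈ S, ∀ w ∈ S, u ≠ w → ¬ G.Adj u w

/-- The independence number `α` of the induced subgraph of `G` on the vertex set `A`. -/
def indepNum {V : Type*} (G : SimpleGraph V) (A : Finset V) : ℕ :=
  (A.powerset.filter (fun S => IsIndep G S)).sup Finset.card

/-- The ordered product `∏_{v ∈ S} h v` (in increasing order of vertices). -/
def hProd {V : Type*} [LinearOrder V] {N : ℕ} (h : V → Matrix (Fin N) (Fin N) ℂ)
    (S : Finset V) : Matrix (Fin N) (Fin N) ℂ :=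
  ((S.sort (· ≤ ·)).map h).prod

/-- The independent set charge `Q^{(i)}` of the induced subgraph on `A`. -/
def chargeQ {V : Type*} [LinearOrder V] {N : ℕ} (G : SimpleGraph V)
    (h : V → Matrix (Fin N) (Fin N) ℂ) (A : Finset V) (i : ℕ) :
    Matrix (Fin N) (Fin N) ℂ :=
  ∑ S ∈ A.powerset.filter (fun S => IsIndep G S ∧ S.card = i), hProd h S

/-- The transfer operator `T(x) = ∑_{k=0}^{α} (−x)^k Q^{(k)}` of the induced subgraph on `A`. -/
def transferT {V : Type*} [LinearOrder V] {N : ℕ} (G : SimpleGraph V)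
    (h : V → Matrix (Fin N) (Fin N) ℂ) (A : Finset V) (x : ℂ) :
    Matrix (Fin N) (Fin N) ℂ :=
  ∑ k ∈ Finset.range (indepNum G A + 1), (-x) ^ k • chargeQ G h A k
/-- An induced path `p 0, p 1, …, p n` in `G`: the vertices are distinct and two of them
are adjacent if and only if they are consecutive. -/
def IsInducedPath {V : Type*} (G : SimpleGraph V) {n : ℕ} (p : Fin (n + 1) → V) : Prop :=
  Function.Injective p ∧
    ∀ i j : Fin (n + 1), G.Adj (p i) (p j) ↔ ((i : ℕ) + 1 = (j : ℕ) ∨ (j : ℕ) + 1 = (i : ℕ))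

/-- A path is a dipath if all of its edges are oriented consistently from one end to the other. -/
def IsDipath {V : Type*} (dir : V → V → Prop) {n : ℕ} (p : Fin (n + 1) → V) : Prop :=
  (∀ i : Fin n, dir (p i.castSucc) (p i.succ)) ∨ (∀ i : Fin n, dir (p i.succ) (p i.castSucc))

/-- An oriented graph is dipath oriented if every induced path is a dipath. -/
def DipathOriented {V : Type*} (G : SimpleGraph V) (dir : V → V → Prop) : Prop :=
  ∀ (n : ℕ) (p : Fin (n + 1) → V), IsInducedPath G p → IsDipath dir p

section Helpers

lemma path3 {V : Type*} (G : SimpleGraph V) (dir : V → V → Prop)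
    (hdip : DipathOriented G dir) {v u w : V} (h1 : G.Adj v u) (h2 : G.Adj u w)
    (hne : v ≠ w) (hn : ¬ G.Adj v w) :
    (dir v u ∧ dir u w) ∨ (dir u v ∧ dir w u) := by
  have hind : IsInducedPath G (n := 2) ![v, u, w] := by
    constructor
    · intro a b hab
      have e1 := h1.ne
      have e2 := h2.ne
      fin_cases a <;> fin_cases b <;> simp_all
    · intro a b
      have h1' := h1.symm
      have h2' := h2.symm
      have hn' : ¬ G.Adj w v := fun hh => hn hh.symm
      fin_cases a <;> fin_cases b <;> simp_all
  rcases hdip 2 _ hind with hh | hh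
  · left
    exact ⟨by simpa using hh 0, by simpa using hh 1⟩
  · right
    exact ⟨by simpa using hh 0, by simpa using hh 1⟩

/-- Adjacency inside `W`. -/
def adjIn {V : Type*} (G : SimpleGraph V) (W : Finset V) (x y : V) : Prop :=
  x ∈ W ∧ y ∈ W ∧ G.Adj x y

lemma adjIn_symm {V : Type*} (G : SimpleGraph V) (W : Finset V) :
    Std.Symm (adjIn G W) := ⟨fun _ _ h => ⟨h.2.1, h.1, h.2.2.symm⟩⟩

/-- Connected component of `x` inside `W`. -/
def compIn {V : Type*} [Fintype V] (G : SimpleGraph V) (W : Finset V) (x : V) : Finset V :=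
  Finset.univ.filter (fun y => Relation.ReflTransGen (adjIn G W) x y)

lemma mem_compIn {V : Type*} [Fintype V] (G : SimpleGraph V) (W : Finset V) (x y : V) :
    y ∈ compIn G W x ↔ Relation.ReflTransGen (adjIn G W) x y := by
  simp [compIn]

lemma rtg_symm {V : Type*} (G : SimpleGraph V) (W : Finset V) {x y : V}
    (h : Relation.ReflTransGen (adjIn G W) x y) : Relation.ReflTransGen (adjIn G W) y x := by
  induction h with
  | refl => exact .refl
  | tail _ hbc ih => exact .head ⟨hbc.2.1, hbc.1, hbc.2.2.symm⟩ ih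

lemma compIn_eq {V : Type*} [Fintype V] (G : SimpleGraph V) (W : Finset V) {x y : V} :
    y ∈ compIn G W x ↔ compIn G W y = compIn G W x := by
  constructor
  · intro h
    rw [mem_compIn] at h
    ext z
    rw [mem_compIn, mem_compIn]
    exact ⟨fun hz => h.trans hz, fun hz => (rtg_symm G W h).trans hz⟩
  · intro h
    rw [← h, mem_compIn]

lemma compIn_adj {V : Type*} [Fintype V] (G : SimpleGraph V) (W : Finset V) {x y : V}
    (hx : x ∈ W) (hy : y ∈ W) (h : G.Adj x y) : compIn G W y = compIn G W x := by
  rw [← compIn_eq, mem_compIn]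
  exact .single ⟨hx, hy, h⟩

lemma compIn_sub {V : Type*} [Fintype V] (G : SimpleGraph V) (W : Finset V) {x y : V}
    (hx : x ∈ W) (hy : y ∈ compIn G W x) : y ∈ W := by
  rw [mem_compIn] at hy
  cases hy with
  | refl => exact hx
  | tail _ h => exact h.2.1

/-- In a partial bijection, connected elements are comparable. -/
lemma comparable {V : Type*} (A R : V → V → Prop) (hA : ∀ x y, A x y → R x y ∨ R y x)
    (hf : ∀ x y z, R x y → R x z → y = z) (hi : ∀ x y z, R x z → R y z → x = y)
    {x y : V} (h : Relation.ReflTransGen A x y) :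
    Relation.ReflTransGen R x y ∨ Relation.ReflTransGen R y x := by
  induction h with
  | refl => exact .inl .refl
  | @tail b c _ hbc ih =>
    rcases hA _ _ hbc with h1 | h1
    · rcases ih with h2 | h2
      · exact .inl (h2.tail h1)
      · rcases Relation.ReflTransGen.cases_head h2 with h3 | ⟨w, h3, h4⟩
        · subst h3
          exact .inl (.single h1)
        · obtain rfl := hf _ _ _ h1 h3
          exact .inr h4
    · rcases ih with h2 | h2
      · rcases Relation.ReflTransGen.cases_tail h2 with h3 | ⟨w, h3, h4⟩
        · subst h3
          exact .inr (.single h1)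
        · obtain rfl := hi _ _ _ h1 h4
          exact .inl h3
      · exact .inr (.head h1 h2)

/-- Sinks in a component are unique. -/
lemma sink_unique {V : Type*} (A R : V → V → Prop) (hA : ∀ x y, A x y → R x y ∨ R y x)
    (hf : ∀ x y z, R x y → R x z → y = z) (hi : ∀ x y z, R x z → R y z → x = y)
    {x y : V} (h : Relation.ReflTransGen A x y) (hx : ∀ z, ¬ R x z) (hy : ∀ z, ¬ R y z) :
    x = y := by
  rcases comparable A R hA hf hi h with h | h
  · rcases Relation.ReflTransGen.cases_head h with h3 | ⟨w, h3, _⟩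
    · exact h3
    · exact absurd h3 (hx _)
  · rcases Relation.ReflTransGen.cases_head h with h3 | ⟨w, h3, _⟩
    · exact h3.symm
    · exact absurd h3 (hy _)

/-- Edge count: number of `R`-edges from `P` to `Q` is `#P` minus number of sinks, which is at
most one. -/
lemma edge_count {V : Type*} (P Q : Finset V) (R : V → V → Prop)
    (hf : ∀ x ∈ P, ∀ y ∈ Q, ∀ z ∈ Q, R x y → R x z → y = z)
    (hs : ∀ x ∈ P, ∀ y ∈ P, (∀ z ∈ Q, ¬ R x z) → (∀ z ∈ Q, ¬ R y z) → x = y) :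
    (∑ u ∈ P, ∑ v ∈ Q, (if R u v then (1 : ℤ) else 0) = P.card) ∨
    (∑ u ∈ P, ∑ v ∈ Q, (if R u v then (1 : ℤ) else 0) = P.card - 1) := by
  have key : ∀ u ∈ P, ∑ v ∈ Q, (if R u v then (1 : ℤ) else 0)
      = 1 - (if ∀ z ∈ Q, ¬ R u z then 1 else 0) := by
    intro u hu
    split_ifs with h
    · rw [Finset.sum_eq_zero]
      · simp
      · intro z hz
        simp [h z hz]
    · push Not at h
      obtain ⟨z, hz, hr⟩ := h
      rw [Finset.sum_eq_single_of_mem z hz]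
      · simp [hr]
      · intro y hy hne
        rw [if_neg]
        exact fun hr' => hne (hf u hu y hy z hz hr' hr)
  rw [Finset.sum_congr rfl key, Finset.sum_sub_distrib]
  have hc : (P.filter (fun u => ∀ z ∈ Q, ¬ R u z)).card ≤ 1 := by
    rw [Finset.card_le_one]
    intro a ha b hb
    rw [Finset.mem_filter] at ha hb
    exact hs a ha.1 b hb.1 ha.2 hb.2
  rw [Finset.sum_boole]
  simp only [Finset.sum_const, nsmul_eq_mul, mul_one]
  omega

/-- Commutation exponent. -/
def epsD {V : Type*} (dir : V → V → Prop) (u v : V) : ℤ :=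
  (if dir u v then 1 else 0) - (if dir v u then 1 else 0)

section Main

variable {V : Type*} [Fintype V] [LinearOrder V]
    (G : SimpleGraph V) (dir : V → V → Prop)

lemma other_side {S T : Finset V} (hS : IsIndep G S) {u v : V} (hu : u ∈ S)
    (hv : v ∈ S ∪ T) (h : G.Adj u v) : v ∈ T := by
  rcases Finset.mem_union.1 hv with hv | hv
  · exact absurd h (hS u hu v hv h.ne)
  · exact hv

lemma other_nonadj {S T : Finset V} (hS : IsIndep G S) (hT : IsIndep G T) {u v w : V}
    (hu : u ∈ S ∪ T) (hv : v ∈ S ∪ T) (hw : w ∈ S ∪ T) (h : G.Adj u v) (k2 : G.Adj u w)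
    (hne : v ≠ w) : ¬ G.Adj v w := by
  rcases Finset.mem_union.1 hu with hu | hu
  · exact hT v (other_side G hS hu hv h) w (other_side G hS hu hw k2) hne
  · rw [Finset.union_comm] at hv hw
    exact hS v (other_side G hT hu hv h) w (other_side G hT hu hw k2) hne

lemma out_unique
    (hdir : ∀ u v, dir u v → G.Adj u v)
    (hdir' : ∀ u v, G.Adj u v → (dir u v ↔ ¬ dir v u))
    (hdip : DipathOriented G dir)
    {S T : Finset V} (hS : IsIndep G S) (hT : IsIndep G T) {u v w : V}
    (hu : u ∈ S ∪ T) (hv : v ∈ S ∪ T) (hw : w ∈ S ∪ T) (h : dir u v) (k2 : dir u w) :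
    v = w := by
  by_contra hne
  have a1 := hdir _ _ h
  have a2 := hdir _ _ k2
  rcases path3 G dir hdip a1.symm a2 hne (other_nonadj G hS hT hu hv hw a1 a2 hne) with k | k
  · exact (hdir' _ _ a1).1 h k.1
  · exact (hdir' _ _ a2).1 k2 k.2

lemma in_unique
    (hdir : ∀ u v, dir u v → G.Adj u v)
    (hdir' : ∀ u v, G.Adj u v → (dir u v ↔ ¬ dir v u))
    (hdip : DipathOriented G dir)
    {S T : Finset V} (hS : IsIndep G S) (hT : IsIndep G T) {u v w : V}
    (hu : u ∈ S ∪ T) (hv : v ∈ S ∪ T) (hw : w ∈ S ∪ T) (h : dir v u) (k2 : dir w u) :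
    v = w := by
  by_contra hne
  have a1 := (hdir _ _ h).symm
  have a2 := (hdir _ _ k2).symm
  rcases path3 G dir hdip a1.symm a2 hne (other_nonadj G hS hT hu hv hw a1 a2 hne) with k | k
  · exact (hdir' _ _ a2).1 k.2 k2
  · exact (hdir' _ _ a1).1 k.1 h

lemma comp_eps
    (hdir : ∀ u v, dir u v → G.Adj u v)
    (hdir' : ∀ u v, G.Adj u v → (dir u v ↔ ¬ dir v u))
    (hdip : DipathOriented G dir)
    {S T : Finset V} (hS : IsIndep G S) (hT : IsIndep G T) {x : V}
    (hx : x ∈ S ∪ T)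
    (hne : (compIn G (S ∪ T) x ∩ S).card ≠ (compIn G (S ∪ T) x ∩ T).card) :
    ∑ u ∈ compIn G (S ∪ T) x ∩ S, ∑ v ∈ compIn G (S ∪ T) x ∩ T, epsD dir u v = 0 := by
  set W := S ∪ T with hW
  set C := compIn G W x with hC
  have hCW : ∀ y ∈ C, y ∈ W := fun y hy => compIn_sub G W hx hy
  have hadj : ∀ y z, y ∈ C → z ∈ W → G.Adj y z → z ∈ C := by
    intro y z hy hz h
    rw [hC, compIn_eq, compIn_adj G W (hCW y hy) hz h, ← compIn_eq]
    exact hy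
  have hconn : ∀ y z, y ∈ C → z ∈ C → Relation.ReflTransGen (adjIn G W) y z := by
    intro y z hy hz
    rw [hC, mem_compIn] at hy hz
    exact (rtg_symm G W hy).trans hz
  -- generic facts about out- and in-relations
  let R : V → V → Prop := fun y z => y ∈ W ∧ z ∈ W ∧ dir y z
  have hAR : ∀ y z, adjIn G W y z → R y z ∨ R z y := by
    intro y z h
    by_cases hd : dir y z
    · exact .inl ⟨h.1, h.2.1, hd⟩
    · exact .inr ⟨h.2.1, h.1, (hdir' _ _ h.2.2.symm).2 hd⟩
  have hRf : ∀ a b c, R a b → R a c → b = c := fun a b c h1 h2 =>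
    out_unique G dir hdir hdir' hdip hS hT h1.1 h1.2.1 h2.2.1 h1.2.2 h2.2.2
  have hRi : ∀ a b c, R a c → R b c → a = b := fun a b c h1 h2 =>
    in_unique G dir hdir hdir' hdip hS hT h1.2.1 h1.1 h2.1 h1.2.2 h2.2.2
  have sinkS : ∀ a ∈ C ∩ S, (∀ z ∈ C ∩ T, ¬ dir a z) → ∀ z, ¬ R a z := by
    intro a ha h z hz
    rw [Finset.mem_inter] at ha
    exact h z (Finset.mem_inter.2 ⟨hadj a z ha.1 hz.2.1 (hdir _ _ hz.2.2),
      other_side G hS ha.2 hz.2.1 (hdir _ _ hz.2.2)⟩) hz.2.2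
  have sinkT : ∀ a ∈ C ∩ T, (∀ z ∈ C ∩ S, ¬ dir a z) → ∀ z, ¬ R a z := by
    intro a ha h z hz
    rw [Finset.mem_inter] at ha
    exact h z (Finset.mem_inter.2 ⟨hadj a z ha.1 hz.2.1 (hdir _ _ hz.2.2),
      other_side G hT ha.2 (Finset.union_comm S T ▸ hz.2.1) (hdir _ _ hz.2.2)⟩) hz.2.2
  have srcS : ∀ a ∈ C ∩ S, (∀ z ∈ C ∩ T, ¬ dir z a) → ∀ z, ¬ R z a := by
    intro a ha h z hz
    rw [Finset.mem_inter] at ha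
    exact h z (Finset.mem_inter.2 ⟨hadj a z ha.1 hz.1 (hdir _ _ hz.2.2).symm,
      other_side G hS ha.2 hz.1 (hdir _ _ hz.2.2).symm⟩) hz.2.2
  have srcT : ∀ a ∈ C ∩ T, (∀ z ∈ C ∩ S, ¬ dir z a) → ∀ z, ¬ R z a := by
    intro a ha h z hz
    rw [Finset.mem_inter] at ha
    exact h z (Finset.mem_inter.2 ⟨hadj a z ha.1 hz.1 (hdir _ _ hz.2.2).symm,
      other_side G hT ha.2 (Finset.union_comm S T ▸ hz.1) (hdir _ _ hz.2.2).symm⟩) hz.2.2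
  have inC : ∀ {X : Finset V} {a}, a ∈ C ∩ X → a ∈ C := fun h => (Finset.mem_inter.1 h).1
  have inW : ∀ {X : Finset V} {a}, a ∈ C ∩ X → a ∈ W := fun h => hCW _ (inC h)
  have e1 := edge_count (C ∩ S) (C ∩ T) dir
    (fun a ha b hb c hc h1 h2 => hRf a b c ⟨inW ha, inW hb, h1⟩ ⟨inW ha, inW hc, h2⟩)
    (fun a ha b hb h1 h2 => sink_unique _ R hAR hRf hRi (hconn a b (inC ha) (inC hb))
      (sinkS a ha h1) (sinkS b hb h2))
  have e2 := edge_count (C ∩ T) (C ∩ S) dir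
    (fun a ha b hb c hc h1 h2 => hRf a b c ⟨inW ha, inW hb, h1⟩ ⟨inW ha, inW hc, h2⟩)
    (fun a ha b hb h1 h2 => sink_unique _ R hAR hRf hRi (hconn a b (inC ha) (inC hb))
      (sinkT a ha h1) (sinkT b hb h2))
  have hAR' : ∀ y z, adjIn G W y z → R z y ∨ R y z := fun y z h => (hAR y z h).symm
  have e3 := edge_count (C ∩ S) (C ∩ T) (fun a b => dir b a)
    (fun a ha b hb c hc h1 h2 => hRi b c a ⟨inW hb, inW ha, h1⟩ ⟨inW hc, inW ha, h2⟩)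
    (fun a ha b hb h1 h2 => sink_unique _ (fun a b => R b a) hAR'
      (fun a b c h1 h2 => hRi b c a h1 h2) (fun a b c h1 h2 => hRf c a b h1 h2)
      (hconn a b (inC ha) (inC hb)) (srcS a ha h1) (srcS b hb h2))
  have e4 := edge_count (C ∩ T) (C ∩ S) (fun a b => dir b a)
    (fun a ha b hb c hc h1 h2 => hRi b c a ⟨inW hb, inW ha, h1⟩ ⟨inW hc, inW ha, h2⟩)
    (fun a ha b hb h1 h2 => sink_unique _ (fun a b => R b a) hAR'
      (fun a b c h1 h2 => hRi b c a h1 h2) (fun a b c h1 h2 => hRf c a b h1 h2)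
      (hconn a b (inC ha) (inC hb)) (srcT a ha h1) (srcT b hb h2))
  rw [Finset.sum_comm] at e2 e4
  simp only [epsD, Finset.sum_sub_distrib]
  omega

/-- The component of `x` in `S ∪ T` is balanced. -/
def Bal (S T : Finset V) (x : V) : Prop :=
  (compIn G (S ∪ T) x ∩ S).card = (compIn G (S ∪ T) x ∩ T).card

/-- Swap the balanced components. -/
def swapF (S T : Finset V) : Finset V :=
  S.filter (fun x => ¬ Bal G S T x) ∪ T.filter (fun x => Bal G S T x)

lemma Bal_comm (S T : Finset V) (x : V) : Bal G T S x ↔ Bal G S T x := by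
  unfold Bal
  rw [Finset.union_comm T S]
  exact eq_comm

lemma mem_swapF (S T : Finset V) (x : V) :
    x ∈ swapF G S T ↔ (x ∈ S ∧ ¬ Bal G S T x) ∨ (x ∈ T ∧ Bal G S T x) := by
  simp [swapF]

lemma swap_union (S T : Finset V) : swapF G S T ∪ swapF G T S = S ∪ T := by
  ext x
  simp only [Finset.mem_union, mem_swapF, Bal_comm G S T]
  tauto

lemma Bal_congr (S T : Finset V) {x y : V}
    (h : y ∈ compIn G (S ∪ T) x) : Bal G S T y ↔ Bal G S T x := by
  unfold Bal
  rw [(compIn_eq G _).1 h]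

lemma comp_swap (S T : Finset V) (x : V) : compIn G (S ∪ T) x ∩ swapF G S T =
    if Bal G S T x then compIn G (S ∪ T) x ∩ T else compIn G (S ∪ T) x ∩ S := by
  ext y
  rw [Finset.mem_inter, mem_swapF]
  split_ifs with hb
  · rw [Finset.mem_inter]
    refine and_congr_right fun hy => ?_
    have := Bal_congr G S T hy
    tauto
  · rw [Finset.mem_inter]
    refine and_congr_right fun hy => ?_
    have := Bal_congr G S T hy
    tauto

lemma Bal_swap (S T : Finset V) (x : V) :
    Bal G (swapF G S T) (swapF G T S) x ↔ Bal G S T x := by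
  have h2 := comp_swap G T S x
  rw [Finset.union_comm T S] at h2
  rw [Bal, swap_union, comp_swap, h2]
  have h3 := Bal_comm G S T x
  by_cases hb : Bal G S T x
  · rw [if_pos hb, if_pos (h3.2 hb)]
    unfold Bal
    exact eq_comm
  · rw [if_neg hb, if_neg (fun h => hb (h3.1 h))]
    rfl

lemma swap_swap (S T : Finset V) : swapF G (swapF G S T) (swapF G T S) = S := by
  ext x
  rw [mem_swapF, Bal_swap, mem_swapF, mem_swapF, Bal_comm G S T]
  tauto

lemma swap_indep {S T : Finset V} (hS : IsIndep G S) (hT : IsIndep G T) :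
    IsIndep G (swapF G S T) := by
  intro u hu w hw hne hadj
  have hb : u ∈ S ∪ T → w ∈ S ∪ T → (Bal G S T w ↔ Bal G S T u) := fun h1 h2 =>
    Bal_congr G S T ((compIn_eq G _).2 (compIn_adj G _ h1 h2 hadj))
  rw [mem_swapF] at hu hw
  simp only [Finset.mem_union] at hb
  have h1 := fun hu hw => hS u hu w hw hne hadj
  have h2 := fun hu hw => hT u hu w hw hne hadj
  tauto

lemma card_bal (S T : Finset V) :
    (S.filter (fun x => Bal G S T x)).card = (T.filter (fun x => Bal G S T x)).card := by
  have gen : ∀ X : Finset V, (X.filter (fun x => Bal G S T x)).card =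
      ∑ C : Finset V, ((X.filter (fun x => Bal G S T x)).filter
        (fun x => compIn G (S ∪ T) x = C)).card := fun X =>
    Finset.card_eq_sum_card_fiberwise (fun _ _ => by simp)
  rw [gen S, gen T]
  refine Finset.sum_congr rfl fun C _ => ?_
  by_cases hC : ∃ x, compIn G (S ∪ T) x = C ∧ Bal G S T x
  · obtain ⟨x, rfl, hx⟩ := hC
    have key : ∀ X : Finset V, (X.filter (fun x => Bal G S T x)).filter
        (fun y => compIn G (S ∪ T) y = compIn G (S ∪ T) x) = compIn G (S ∪ T) x ∩ X := by
      intro X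
      ext y
      rw [Finset.mem_filter, Finset.mem_filter, Finset.mem_inter, ← compIn_eq]
      have := fun hy => Bal_congr G S T (x := x) (y := y) hy
      tauto
    rw [key, key]
    exact hx
  · have key : ∀ X : Finset V, (X.filter (fun x => Bal G S T x)).filter
        (fun y => compIn G (S ∪ T) y = C) = ∅ := by
      intro X
      rw [Finset.eq_empty_iff_forall_notMem]
      intro y hy
      rw [Finset.mem_filter, Finset.mem_filter] at hy
      exact hC ⟨y, hy.2, hy.1.2⟩
    rw [key, key]

lemma swap_card (S T : Finset V) : (swapF G S T).card = S.card := by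
  rw [swapF, Finset.card_union_of_disjoint, ← card_bal, add_comm,
    Finset.card_filter_add_card_filter_not]
  rw [Finset.disjoint_left]
  intro x hx hy
  exact (Finset.mem_filter.1 hx).2 (Finset.mem_filter.1 hy).2

lemma eps_sum_zero
    (hdir : ∀ u v, dir u v → G.Adj u v)
    (hdir' : ∀ u v, G.Adj u v → (dir u v ↔ ¬ dir v u))
    (hdip : DipathOriented G dir)
    {S T : Finset V} (hS : IsIndep G S) (hT : IsIndep G T) :
    ∑ u ∈ S.filter (fun x => ¬ Bal G S T x), ∑ v ∈ T.filter (fun x => ¬ Bal G S T x),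
      epsD dir u v = 0 := by
  rw [← Finset.sum_fiberwise (S.filter (fun x => ¬ Bal G S T x)) (compIn G (S ∪ T))]
  refine Finset.sum_eq_zero fun C _ => ?_
  by_cases hC : ∃ x ∈ S, compIn G (S ∪ T) x = C ∧ ¬ Bal G S T x
  · obtain ⟨x, hxS, rfl, hx⟩ := hC
    have key : (S.filter (fun x => ¬ Bal G S T x)).filter
        (fun y => compIn G (S ∪ T) y = compIn G (S ∪ T) x) = compIn G (S ∪ T) x ∩ S := by
      ext y
      rw [Finset.mem_filter, Finset.mem_filter, Finset.mem_inter, ← compIn_eq]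
      have := fun hy => Bal_congr G S T (x := x) (y := y) hy
      tauto
    rw [key, ← comp_eps G dir hdir hdir' hdip hS hT (Finset.mem_union_left _ hxS) hx]
    refine Finset.sum_congr rfl fun u hu => ?_
    rw [Finset.mem_inter] at hu
    symm
    apply Finset.sum_subset
    · intro y hy
      rw [Finset.mem_inter] at hy
      rw [Finset.mem_filter, Bal_congr G S T hy.1]
      exact ⟨hy.2, hx⟩
    · intro y hy hn
      rw [Finset.mem_filter] at hy
      have hna : ¬ G.Adj u y := by
        intro ha
        apply hn
        rw [Finset.mem_inter, compIn_eq, compIn_adj G _ (Finset.mem_union_left _ hu.2)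
          (Finset.mem_union_right _ hy.1) ha, ← compIn_eq]
        exact ⟨hu.1, hy.1⟩
      rw [epsD, if_neg (fun h => hna (hdir _ _ h)), if_neg (fun h => hna (hdir _ _ h).symm)]
      rfl
  · rw [Finset.sum_eq_zero]
    intro y hy
    rw [Finset.mem_filter, Finset.mem_filter] at hy
    exact absurd ⟨y, hy.1.1, hy.2, hy.1.2⟩ hC

variable {N : ℕ} (h : V → Matrix (Fin N) (Fin N) ℂ)

lemma hProd_union (S T : Finset V) (hd : Disjoint S T)
    (hc : ∀ u ∈ S ∪ T, ∀ v ∈ S ∪ T, Commute (h u) (h v)) :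
    hProd h (S ∪ T) = hProd h S * hProd h T := by
  unfold hProd
  rw [← List.prod_append, ← List.map_append]
  apply List.Perm.prod_eq'
  · apply List.Perm.map
    rw [List.perm_ext_iff_of_nodup]
    · intro a
      simp
    · exact Finset.sort_nodup _ _
    · rw [List.nodup_append']
      refine ⟨Finset.sort_nodup _ _, Finset.sort_nodup _ _, ?_⟩
      intro a ha hb
      rw [Finset.mem_sort] at ha hb
      exact Finset.disjoint_left.1 hd ha hb
  · rw [List.pairwise_map]
    apply List.pairwise_of_forall_mem_list
    intro a ha b hb
    rw [Finset.mem_sort] at ha hb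
    exact hc a ha b hb

lemma hProd_sum (f : V → ℤ) (S : Finset V) :
    ((S.sort (· ≤ ·)).map f).sum = ∑ u ∈ S, f u := by
  rw [← List.sum_toFinset _ (Finset.sort_nodup _ _), Finset.sort_toFinset]

lemma list_comm1 (w : ℂ) (hw : w ≠ 0) (e : V → V → ℤ)
    (he : ∀ u v, h u * h v = w ^ e u v • (h v * h u)) (L : List V) (v : V) :
    (L.map h).prod * h v = w ^ (L.map (fun u => e u v)).sum • (h v * (L.map h).prod) := by
  induction L with
  | nil => simp
  | cons a L ih =>
    simp only [List.map_cons, List.prod_cons, List.sum_cons]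
    rw [mul_assoc, ih, mul_smul_comm, ← mul_assoc, he a v, smul_mul_assoc, smul_smul,
      ← zpow_add₀ hw, add_comm, mul_assoc]

lemma list_comm2 (w : ℂ) (hw : w ≠ 0) (e : V → V → ℤ)
    (he : ∀ u v, h u * h v = w ^ e u v • (h v * h u)) (L M : List V) :
    (L.map h).prod * (M.map h).prod =
      w ^ (M.map (fun v => (L.map (fun u => e u v)).sum)).sum •
        ((M.map h).prod * (L.map h).prod) := by
  induction M with
  | nil => simp
  | cons a M ih =>
    simp only [List.map_cons, List.prod_cons, List.sum_cons]
    rw [← mul_assoc, list_comm1 h w hw e he, smul_mul_assoc, mul_assoc, ih, mul_smul_comm,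
      smul_smul, ← zpow_add₀ hw, mul_assoc]

lemma hProd_comm (w : ℂ) (hw : w ≠ 0) (e : V → V → ℤ)
    (he : ∀ u v, h u * h v = w ^ e u v • (h v * h u)) (S T : Finset V)
    (hz : ∑ u ∈ S, ∑ v ∈ T, e u v = 0) : hProd h S * hProd h T = hProd h T * hProd h S := by
  have := list_comm2 h w hw e he (S.sort (· ≤ ·)) (T.sort (· ≤ ·))
  simp only [hProd_sum] at this
  rw [Finset.sum_comm, hz, zpow_zero, one_smul] at this
  exact this

lemma swap_prod
    (hdir : ∀ u v, dir u v → G.Adj u v)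
    (hdir' : ∀ u v, G.Adj u v → (dir u v ↔ ¬ dir v u))
    (hdip : DipathOriented G dir)
    (w : ℂ) (hw : w ≠ 0)
    (hcd : ∀ u v, dir u v → h u * h v = w • (h v * h u))
    (hcn : ∀ u v, u ≠ v → ¬ G.Adj u v → h u * h v = h v * h u)
    {S T : Finset V} (hS : IsIndep G S) (hT : IsIndep G T) :
    hProd h S * hProd h T = hProd h (swapF G T S) * hProd h (swapF G S T) := by
  have he : ∀ u v, h u * h v = w ^ epsD dir u v • (h v * h u) := by
    intro u v
    unfold epsD
    by_cases ha : G.Adj u v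
    · by_cases h1 : dir u v
      · have h2 := (hdir' u v ha).1 h1
        simp [h1, h2, hcd u v h1]
      · have h2 := (hdir' v u ha.symm).2 h1
        simp [h1, h2, hcd v u h2, smul_smul, hw]
    · have h1 : ¬ dir u v := fun hh => ha (hdir _ _ hh)
      have h2 : ¬ dir v u := fun hh => ha (hdir _ _ hh).symm
      by_cases hne : u = v
      · subst hne
        simp
      · simp [h1, h2, hcn u v hne ha]
  have hci : ∀ X : Finset V, IsIndep G X → ∀ u ∈ X, ∀ v ∈ X, Commute (h u) (h v) := by
    intro X hX u hu v hv
    by_cases hne : u = v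
    · subst hne
      exact Commute.refl _
    · exact hcn u v hne (hX u hu v hv hne)
  have hdj : ∀ X Y : Finset V, Disjoint (X.filter (fun x => ¬ Bal G S T x))
      (Y.filter (fun x => Bal G S T x)) := by
    intro X Y
    rw [Finset.disjoint_left]
    intro x hx hy
    exact (Finset.mem_filter.1 hx).2 (Finset.mem_filter.1 hy).2
  have split : ∀ X : Finset V, IsIndep G X → hProd h X =
      hProd h (X.filter (fun x => ¬ Bal G S T x)) * hProd h (X.filter (fun x => Bal G S T x)) := by
    intro X hX
    have hu : X.filter (fun x => ¬ Bal G S T x) ∪ X.filter (fun x => Bal G S T x) = X := by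
      ext x
      simp only [Finset.mem_union, Finset.mem_filter]
      tauto
    rw [← hProd_union h _ _ (hdj X X), hu]
    rw [hu]
    exact hci X hX
  have sS : hProd h (swapF G S T) = hProd h (S.filter (fun x => ¬ Bal G S T x)) *
      hProd h (T.filter (fun x => Bal G S T x)) :=
    hProd_union h _ _ (hdj S T) (hci _ (swap_indep G hS hT))
  have sT : hProd h (swapF G T S) = hProd h (T.filter (fun x => ¬ Bal G S T x)) *
      hProd h (S.filter (fun x => Bal G S T x)) := by
    have e : swapF G T S = T.filter (fun x => ¬ Bal G S T x) ∪ S.filter (fun x => Bal G S T x) := by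
      simp only [swapF, Bal_comm G S T]
    rw [e, hProd_union h _ _ (hdj T S)]
    rw [← e]
    exact hci _ (swap_indep G hT hS)
  have cross : ∀ X ⊆ S ∪ T, ∀ Y ⊆ S ∪ T, hProd h (X.filter (fun x => Bal G S T x)) *
      hProd h (Y.filter (fun x => ¬ Bal G S T x)) =
      hProd h (Y.filter (fun x => ¬ Bal G S T x)) * hProd h (X.filter (fun x => Bal G S T x)) := by
    intro X hX Y hY
    apply hProd_comm h w hw _ he
    refine Finset.sum_eq_zero fun u hu => Finset.sum_eq_zero fun v hv => ?_
    rw [Finset.mem_filter] at hu hv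
    have hna : ¬ G.Adj u v := by
      intro ha
      exact hv.2 ((Bal_congr G S T ((compIn_eq G _).2 (compIn_adj G _ (hX hu.1) (hY hv.1) ha))).2 hu.2)
    rw [epsD, if_neg (fun h => hna (hdir _ _ h)), if_neg (fun h => hna (hdir _ _ h).symm)]
    rfl
  have hub := hProd_comm h w hw _ he _ _ (eps_sum_zero G dir hdir hdir' hdip hS hT)
  have c1 := cross S Finset.subset_union_left T Finset.subset_union_right
  have c2 := cross S Finset.subset_union_left S Finset.subset_union_left
  rw [split S hS, split T hT, sS, sT]
  generalize hProd h (S.filter (fun x => Bal G S T x)) = s2 at *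
  generalize hProd h (T.filter (fun x => Bal G S T x)) = t2 at *
  generalize hProd h (S.filter (fun x => ¬ Bal G S T x)) = s1 at *
  generalize hProd h (T.filter (fun x => ¬ Bal G S T x)) = t1 at *
  calc s1 * s2 * (t1 * t2) = s1 * (s2 * t1) * t2 := by simp only [mul_assoc]
    _ = (s1 * t1) * s2 * t2 := by rw [c1]; simp only [mul_assoc]
    _ = t1 * (s1 * s2) * t2 := by rw [hub]; simp only [mul_assoc]
    _ = t1 * s2 * (s1 * t2) := by rw [← c2]; simp only [mul_assoc]

end Main

end Helpers

/-- for a Hamiltonian compatible with a dipath-oriented graph,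
the independent set charges pairwise commute. -/
theorem independent_set_charges_commute
    {V : Type*} [Fintype V] [LinearOrder V] {N : ℕ}
    (d : ℕ) (hd : 2 ≤ d)
    (G : SimpleGraph V) (dir : V → V → Prop)
    (hdir : ∀ u v, dir u v → G.Adj u v)
    (hdir' : ∀ u v, G.Adj u v → (dir u v ↔ ¬ dir v u))
    (hdip : DipathOriented G dir)
    (h : V → Matrix (Fin N) (Fin N) ℂ) (b : V → ℝ)
    (hb : ∀ v, b v ≠ 0)
    (hpow : ∀ v, h v ^ d = ((b v : ℂ) ^ d) • (1 : Matrix (Fin N) (Fin N) ℂ))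
    (hcd : ∀ u v, dir u v → h u * h v = omegaD d • (h v * h u))
    (hcn : ∀ u v, u ≠ v → ¬ G.Adj u v → h u * h v = h v * h u)
    (i j : ℕ) (hi : i ≤ indepNum G Finset.univ) (hj : j ≤ indepNum G Finset.univ) :
    chargeQ G h Finset.univ i * chargeQ G h Finset.univ j =
      chargeQ G h Finset.univ j * chargeQ G h Finset.univ i := by

  have hw : omegaD d ≠ 0 := Complex.exp_ne_zero _
  unfold chargeQ
  rw [Finset.sum_mul_sum, Finset.sum_mul_sum, Finset.sum_comm (s := Finset.filter _ _)
    (t := Finset.filter (fun S => IsIndep G S ∧ S.card = i) _), ← Finset.sum_product',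
    ← Finset.sum_product']
  refine Finset.sum_bij' (fun p _ => (swapF G p.1 p.2, swapF G p.2 p.1))
    (fun p _ => (swapF G p.1 p.2, swapF G p.2 p.1)) ?_ ?_ ?_ ?_ ?_
  all_goals
    rintro ⟨S, T⟩ hp
    simp only [Finset.mem_product, Finset.mem_filter, Finset.powerset_univ, Finset.mem_univ,
      true_and] at hp ⊢
  · exact ⟨⟨swap_indep G hp.1.1 hp.2.1, by rw [swap_card]; exact hp.1.2⟩,
      ⟨swap_indep G hp.2.1 hp.1.1, by rw [swap_card]; exact hp.2.2⟩⟩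
  · exact ⟨⟨swap_indep G hp.1.1 hp.2.1, by rw [swap_card]; exact hp.1.2⟩,
      ⟨swap_indep G hp.2.1 hp.1.1, by rw [swap_card]; exact hp.2.2⟩⟩
  · rw [swap_swap, swap_swap]
  · rw [swap_swap, swap_swap]
  · exact swap_prod G dir h hdir hdir' hdip (omegaD d) hw hcd hcn hp.1.1 hp.2.1
end
end

section
/- Let G = (V,E) be a finite oriented graph. There exists a dipath-oriented graph in the switching orbit of G if and only if there exists a function s : V → 𝔽₂ such that for every induced path on three vertices u, v, w (i.e., u and w are both adjacent to v and u, w are non-adjacent), x_{(u,v)} + x_{(v,w)} + s(u) + s(w) = 0 in 𝔽₂, where for adjacent vertices a, b one sets x_{(a,b)} = 1 if the edge {a,b} is oriented from a to b and x_{(a,b)} = 0 otherwise. -/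
noncomputable section
open scoped Classical
/-- The orientation obtained from `dir` by switching at the set of vertices
`{v | s v = true}`: edges with exactly one endpoint in the set are reversed. -/
def switchDir {V : Type*} (s : V → Bool) (dir : V → V → Prop) (u v : V) : Prop :=
  if s u ≠ s v then dir v u else dir u v

/-- The indicator `x_{(a,c)} ∈ 𝔽₂` of the edge `{a,c}` being oriented from `a` to `c`. -/
def edgeVar {V : Type*} (dir : V → V → Prop) (a c : V) : ZMod 2 :=
  if dir a c then 1 else 0

theorem switch_key {V : Type*} (G : SimpleGraph V) (dir : V → V → Prop)
    (hdir' : ∀ u v, G.Adj u v → (dir u v ↔ ¬ dir v u)) (s : V → Bool) (u v w : V)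
    (huv : G.Adj u v) (hvw : G.Adj v w) :
    (switchDir s dir u v ↔ switchDir s dir v w) ↔
      edgeVar dir u v + edgeVar dir v w + (if s u then 1 else 0) + (if s w then 1 else 0) = 0 := by
  have h1 := hdir' u v huv
  have h2 := hdir' v w hvw
  have e2 : (1 : ZMod 2) + 1 = 0 := by decide
  have e3 : (1 : ZMod 2) + 1 + 1 ≠ 0 := by decide
  have e4 : (1 : ZMod 2) + 1 + 1 + 1 = 0 := by decide
  unfold switchDir edgeVar
  by_cases a : dir v u <;> by_cases b : dir w v <;> cases s u <;> cases s v <;> cases s w <;>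
    simp_all

theorem switch_anti {V : Type*} (G : SimpleGraph V) (dir : V → V → Prop)
    (hdir' : ∀ u v, G.Adj u v → (dir u v ↔ ¬ dir v u)) (s : V → Bool) (u v : V)
    (huv : G.Adj u v) : switchDir s dir u v ↔ ¬ switchDir s dir v u := by
  have h1 := hdir' u v huv
  unfold switchDir
  cases s u <;> cases s v <;> simp_all

theorem exists_dipathOriented_switching_iff
    {V : Type*} [Fintype V] (G : SimpleGraph V) (dir : V → V → Prop)
    (hdir : ∀ u v, dir u v → G.Adj u v)
    (hdir' : ∀ u v, G.Adj u v → (dir u v ↔ ¬ dir v u)) :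
    (∃ s : V → Bool, DipathOriented G (switchDir s dir)) ↔
      (∃ t : V → ZMod 2, ∀ u v w : V, G.Adj u v → G.Adj v w → u ≠ w → ¬ G.Adj u w →
        edgeVar dir u v + edgeVar dir v w + t u + t w = 0) := by
  constructor
  · rintro ⟨s, hs⟩
    refine ⟨fun v => if s v then 1 else 0, fun u v w huv hvw hne hnadj => ?_⟩
    rw [← switch_key G dir hdir' s u v w huv hvw]
    have hp : IsInducedPath G (n := 2) ![u, v, w] := by
      have n1 := huv.ne
      have n2 := hvw.ne
      have hnadj' : ¬ G.Adj w u := fun h => hnadj h.symm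
      constructor
      · intro i j h
        fin_cases i <;> fin_cases j <;> simp_all
      · intro i j
        fin_cases i <;> fin_cases j <;> simp [huv, hvw, huv.symm, hvw.symm, hnadj, hnadj']
    have a1 := switch_anti G dir hdir' s u v huv
    have a2 := switch_anti G dir hdir' s v w hvw
    rcases hs 2 _ hp with h | h
    · have h0 := h 0
      have h1 := h 1
      simp at h0 h1
      tauto
    · have h0 := h 0
      have h1 := h 1
      simp at h0 h1
      tauto
  · rintro ⟨t, ht⟩
    let s : V → Bool := fun v => decide (t v = 1)
    have hst : ∀ v, (if s v then (1 : ZMod 2) else 0) = t v := by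
      intro v
      have : ∀ x : ZMod 2, (if x = 1 then (1 : ZMod 2) else 0) = x := by
        intro x
        have h : ∀ y : ZMod 2, y = 0 ∨ y = 1 := by decide
        rcases h x with rfl | rfl
        · exact if_neg (by decide)
        · exact if_pos rfl
      simpa [s] using this (t v)
    refine ⟨s, fun n p hp => ?_⟩
    obtain ⟨hinj, hadj⟩ := hp
    have step : ∀ (k : ℕ) (hk : k + 2 < n + 1),
        (switchDir s dir (p ⟨k, by omega⟩) (p ⟨k + 1, by omega⟩) ↔
          switchDir s dir (p ⟨k + 1, by omega⟩) (p ⟨k + 2, hk⟩)) := by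
      intro k hk
      have A1 : G.Adj (p ⟨k, by omega⟩) (p ⟨k + 1, by omega⟩) := (hadj _ _).2 (Or.inl rfl)
      have A2 : G.Adj (p ⟨k + 1, by omega⟩) (p ⟨k + 2, hk⟩) := (hadj _ _).2 (Or.inl rfl)
      rw [switch_key G dir hdir' s _ _ _ A1 A2, hst, hst]
      refine ht _ _ _ A1 A2 (fun h => ?_) (fun h => ?_)
      · have := congrArg Fin.val (hinj h)
        simp at this
      · have := (hadj _ _).1 h
        simp at this
        omega
    have all : ∀ (k : ℕ) (hk : k + 1 < n + 1),
        (switchDir s dir (p ⟨k, by omega⟩) (p ⟨k + 1, hk⟩) ↔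
          switchDir s dir (p ⟨0, by omega⟩) (p ⟨0 + 1, by omega⟩)) := by
      intro k
      induction k with
      | zero => intro hk; rfl
      | succ k ih => intro hk; exact (step k hk).symm.trans (ih (by omega))
    by_cases hn : n = 0
    · subst hn
      exact Or.inl fun i => i.elim0
    by_cases h0 : switchDir s dir (p ⟨0, by omega⟩) (p ⟨0 + 1, by omega⟩)
    · left
      rintro ⟨i, hi⟩
      exact (all i (by omega)).2 h0
    · right
      rintro ⟨i, hi⟩
      have A : G.Adj (p ⟨i + 1, by omega⟩) (p ⟨i, by omega⟩) := (hadj _ _).2 (Or.inr rfl)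
      exact (switch_anti G dir hdir' s _ _ A).2 fun h => h0 ((all i (by omega)).1 h)
end
end

section
/- A finite oriented graph is dipath oriented if and only if every induced path on three vertices is a dipath. -/
noncomputable section
open scoped Classical
/-- a finite oriented graph is dipath oriented if and only if every
induced path on three vertices is a dipath. -/
theorem dipathOriented_iff_paths_of_length_two
    {V : Type*} [Fintype V] (G : SimpleGraph V) (dir : V → V → Prop)
    (hdir : ∀ u v, dir u v → G.Adj u v)
    (hdir' : ∀ u v, G.Adj u v → (dir u v ↔ ¬ dir v u)) :
    DipathOriented G dir ↔
      ∀ u v w : V, G.Adj u v → G.Adj v w → u ≠ w → ¬ G.Adj u w →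
        ((dir u v ∧ dir v w) ∨ (dir w v ∧ dir v u)) := by
  constructor
  · intro h u v w huv hvw hne hn
    have hwu : ¬ G.Adj w u := fun h => hn h.symm
    have hp : IsInducedPath G (n := 2) ![u, v, w] := by
      constructor
      · intro i j hij
        have h1 := huv.ne
        have h2 := hvw.ne
        fin_cases i <;> fin_cases j <;>
          simp [h1, h2, hne, h1.symm, h2.symm, hne.symm] at hij ⊢
      · intro i j
        have h1 := huv.symm
        have h2 := hvw.symm
        fin_cases i <;> fin_cases j <;> simp [h1, h2, huv, hvw, hn, hwu]
    rcases h 2 _ hp with h | h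
    · left
      have h0 := h 0
      have h1 := h 1
      exact ⟨by simpa using h0, by simpa using h1⟩
    · right
      have h0 := h 0
      have h1 := h 1
      exact ⟨by simpa using h1, by simpa using h0⟩
  · intro h n p hp
    obtain ⟨hinj, hadj⟩ := hp
    have step : ∀ k (hk : k + 2 < n + 1),
        (dir (p ⟨k, by omega⟩) (p ⟨k+1, by omega⟩) ∧
          dir (p ⟨k+1, by omega⟩) (p ⟨k+2, hk⟩)) ∨
        (dir (p ⟨k+2, hk⟩) (p ⟨k+1, by omega⟩) ∧
          dir (p ⟨k+1, by omega⟩) (p ⟨k, by omega⟩)) := by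
      intro k hk
      apply h
      · rw [hadj]; simp
      · rw [hadj]; simp
      · intro e
        have := congrArg Fin.val (hinj e)
        simp at this
      · rw [hadj]; simp; omega
    have asym : ∀ u v, dir u v → ¬ dir v u := fun u v e => (hdir' u v (hdir u v e)).1 e
    rcases Nat.eq_zero_or_pos n with rfl | hn
    · left
      intro i
      exact i.elim0
    have h01 : G.Adj (p ⟨0, by omega⟩) (p ⟨1, by omega⟩) := by rw [hadj]; simp
    by_cases hd : dir (p ⟨0, by omega⟩) (p ⟨1, by omega⟩)
    · left
      have key : ∀ k (hk : k + 1 < n + 1), dir (p ⟨k, by omega⟩) (p ⟨k+1, hk⟩) := by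
        intro k
        induction k with
        | zero => intro _; exact hd
        | succ k ih =>
          intro hk
          rcases step k hk with e | e
          · exact e.2
          · exact absurd e.2 (asym _ _ (ih (by omega)))
      intro i
      exact key i (by omega)
    · right
      have hd' := (hdir' _ _ h01.symm).2 hd
      have key : ∀ k (hk : k + 1 < n + 1), dir (p ⟨k+1, hk⟩) (p ⟨k, by omega⟩) := by
        intro k
        induction k with
        | zero => intro _; exact hd'
        | succ k ih =>
          intro hk
          rcases step k hk with e | e
          · exact absurd e.1 (asym _ _ (ih (by omega)))
          · exact e.1
      intro i
      exact key i (by omega)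
end
end

section
/- Let G = (V,E) be a finite simple graph, let (h_u)_{u∈V} be N×N complex matrices with h_u h_w = h_w h_u whenever u ≠ w are non-adjacent, and let K be a clique in G. Then for all x ∈ ℂ, T_G(x) = T_{G∖K}(x) − x · ∑_{v∈K} h_v · T_{G∖N[v]}(x). -/
noncomputable section
open scoped Classical

/-- The closed neighbourhood `N[v]` of a vertex. -/
def closedNbhd {V : Type*} [Fintype V] (G : SimpleGraph V) (v : V) : Finset V :=
  insert v (Finset.univ.filter (fun u => G.Adj v u))
theorem hProd_insert_aux {V : Type*} [LinearOrder V] {N : ℕ} (G : SimpleGraph V)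
    (h : V → Matrix (Fin N) (Fin N) ℂ)
    (hcomm : ∀ u w, u ≠ w → ¬ G.Adj u w → h u * h w = h w * h u)
    (v : V) (S : Finset V) (hv : v ∉ S) (hS : IsIndep G (insert v S)) :
    hProd h (insert v S) = h v * hProd h S := by
  have hp : ((insert v S).sort (· ≤ ·)).Perm (v :: S.sort (· ≤ ·)) := by
    rw [List.perm_ext_iff_of_nodup]
    · intro a; simp
    · exact Finset.sort_nodup _ _
    · simp [hv]
  unfold hProd
  rw [← List.prod_cons, ← List.map_cons]
  refine (hp.map h).prod_eq' ?_
  rw [List.pairwise_map]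
  refine (Finset.sort_nodup (insert v S) (· ≤ ·)).imp_of_mem ?_
  intro a b ha hb hab
  rw [Finset.mem_sort] at ha hb
  exact hcomm a b hab (hS a ha b hb hab)

theorem transferT_eq_aux {V : Type*} [LinearOrder V] {N : ℕ} (G : SimpleGraph V)
    (h : V → Matrix (Fin N) (Fin N) ℂ) (A : Finset V) (x : ℂ) :
    transferT G h A x =
      ∑ S ∈ A.powerset.filter (fun S => IsIndep G S), (-x) ^ S.card • hProd h S := by
  unfold transferT chargeQ
  rw [← Finset.sum_fiberwise_of_maps_to (s := A.powerset.filter (fun S => IsIndep G S))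
    (t := Finset.range (indepNum G A + 1)) (g := Finset.card)]
  · refine Finset.sum_congr rfl fun k _ => ?_
    rw [Finset.smul_sum, Finset.filter_filter]
    refine Finset.sum_congr rfl fun S hS => ?_
    rw [(Finset.mem_filter.1 hS).2.2]
  · intro S hS
    rw [Finset.mem_range, Nat.lt_succ_iff]
    exact Finset.le_sup (f := Finset.card) hS

/-- clique recursion relation for the transfer operator. -/
theorem transfer_clique_recursion
    {V : Type*} [Fintype V] [LinearOrder V] {N : ℕ}
    (G : SimpleGraph V) (h : V → Matrix (Fin N) (Fin N) ℂ)
    (hcomm : ∀ u w, u ≠ w → ¬ G.Adj u w → h u * h w = h w * h u)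
    (K : Finset V) (hK : ∀ u ∈ K, ∀ w ∈ K, u ≠ w → G.Adj u w) (x : ℂ) :
    transferT G h Finset.univ x =
      transferT G h (Finset.univ \ K) x -
        x • ∑ v ∈ K, h v * transferT G h (Finset.univ \ closedNbhd G v) x := by
  have key : ∀ v ∈ K, -(x • (h v * transferT G h (Finset.univ \ closedNbhd G v) x)) =
      ∑ S ∈ (Finset.univ : Finset V).powerset.filter (fun S => IsIndep G S),
        if v ∈ S then (-x) ^ S.card • hProd h S else 0 := by
    intro v hv
    rw [transferT_eq_aux, ← Finset.sum_filter, Finset.mul_sum, Finset.smul_sum,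
      ← Finset.sum_neg_distrib]
    have hmem : ∀ S : Finset V,
        S ∈ (Finset.univ \ closedNbhd G v).powerset.filter (fun S => IsIndep G S) ↔
          (v ∉ S ∧ IsIndep G (insert v S)) := by
      intro S
      simp only [Finset.mem_filter, Finset.mem_powerset, Finset.subset_iff, Finset.mem_sdiff,
        Finset.mem_univ, true_and]
      simp only [closedNbhd, Finset.mem_insert, Finset.mem_filter, Finset.mem_univ, true_and,
        IsIndep, not_or]
      constructor
      · rintro ⟨h1, h2⟩
        refine ⟨fun hvS => (h1 hvS).1 rfl, ?_⟩
        rintro a (rfl | ha) b (rfl | hb) hab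
        · exact absurd rfl hab
        · exact (h1 hb).2
        · exact fun hh => (h1 ha).2 hh.symm
        · exact h2 a ha b hb hab
      · rintro ⟨h1, h2⟩
        refine ⟨fun {a} ha => ?_, fun a ha b hb => h2 a (Or.inr ha) b (Or.inr hb)⟩
        have hne : a ≠ v := fun e => h1 (e ▸ ha)
        exact ⟨hne, h2 v (Or.inl rfl) a (Or.inr ha) hne.symm⟩
    refine Finset.sum_bij' (fun S _ => insert v S) (fun S _ => S.erase v) ?_ ?_ ?_ ?_ ?_
    · intro S hS
      have := (hmem S).1 hS
      simp [this.2]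
    · intro S hS
      rw [Finset.mem_filter, Finset.mem_filter] at hS
      rw [hmem, Finset.insert_erase hS.2]
      exact ⟨Finset.notMem_erase _ _, hS.1.2⟩
    · intro S hS
      exact Finset.erase_insert ((hmem S).1 hS).1
    · intro S hS
      exact Finset.insert_erase (Finset.mem_filter.1 hS).2
    · intro S hS
      obtain ⟨h1, h2⟩ := (hmem S).1 hS
      rw [hProd_insert_aux G h hcomm v S h1 h2, Finset.card_insert_of_notMem h1,
        mul_smul_comm, smul_smul, ← neg_smul, pow_succ]
      congr 1
      ring
  rw [sub_eq_add_neg, Finset.smul_sum, ← Finset.sum_neg_distrib, Finset.sum_congr rfl key,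
    Finset.sum_comm, transferT_eq_aux, transferT_eq_aux]
  have hf : (Finset.univ \ K).powerset.filter (fun S => IsIndep G S) =
      ((Finset.univ : Finset V).powerset.filter (fun S => IsIndep G S)).filter
        (fun S => Disjoint S K) := by
    ext S
    simp only [Finset.mem_filter, Finset.mem_powerset, Finset.subset_iff, Finset.mem_sdiff,
      Finset.mem_univ, true_and, Finset.disjoint_left, implies_true]
    tauto
  rw [hf, Finset.sum_filter (fun S => Disjoint S K), ← Finset.sum_add_distrib]
  refine Finset.sum_congr rfl fun S hS => ?_
  have hS := (Finset.mem_filter.1 hS).2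
  by_cases hd : Disjoint S K
  · rw [if_pos hd, Finset.sum_eq_zero, add_zero]
    intro v hv
    rw [if_neg (Finset.disjoint_right.1 hd hv)]
  · rw [if_neg hd, zero_add]
    obtain ⟨v, hvS, hvK⟩ := Finset.not_disjoint_iff.1 hd
    rw [Finset.sum_eq_single_of_mem v hvK, if_pos hvS]
    intro w hw hne
    rw [if_neg]
    intro hwS
    exact hS w hwS v hvS hne (hK w hw v hvK hne)
end
end

section
/- Let G = (V,E) be a finite simple graph with complex vertex weights (w_u)_{u∈V}, and let K be a clique in G. Then for all x ∈ ℂ, Z_G(x) = Z_{G∖K}(x) + x · ∑_{v∈K} w_v · Z_{G∖N[v]}(x). -/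
noncomputable section
open scoped Classical

/-- The independence polynomial `Z(x) = ∑_{I independent} ∏_{u ∈ I} x·w u`
of the induced subgraph on `A`, with vertex weights `w`. -/
def indepPoly {V : Type*} (G : SimpleGraph V) (w : V → ℂ) (A : Finset V) (x : ℂ) : ℂ :=
  ∑ S ∈ A.powerset.filter (fun S => IsIndep G S), ∏ u ∈ S, (x * w u)
/-- clique recursion relation for the independence polynomial. -/
theorem indepPoly_clique_recursion
    {V : Type*} [Fintype V] (G : SimpleGraph V) (w : V → ℂ)
    (K : Finset V) (hK : ∀ u ∈ K, ∀ v ∈ K, u ≠ v → G.Adj u v) (x : ℂ) :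
    indepPoly G w Finset.univ x =
      indepPoly G w (Finset.univ \ K) x +
        x * ∑ v ∈ K, w v * indepPoly G w (Finset.univ \ closedNbhd G v) x := by
  classical
  have hsplit := Finset.sum_filter_add_sum_filter_not
    ((Finset.univ : Finset V).powerset.filter (fun S => IsIndep G S))
    (fun S => Disjoint S K) (fun S => ∏ u ∈ S, (x * w u))
  unfold indepPoly
  rw [← hsplit]
  congr 1
  · apply Finset.sum_congr _ (fun _ _ => rfl)
    ext S
    simp only [Finset.mem_filter, Finset.mem_powerset, Finset.subset_sdiff]
    tauto
  · have hU : ((Finset.univ : Finset V).powerset.filter (fun S => IsIndep G S)).filter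
        (fun S => ¬ Disjoint S K) =
        K.biUnion (fun v => (Finset.univ : Finset V).powerset.filter
          (fun S => IsIndep G S ∧ v ∈ S)) := by
      ext S
      simp only [Finset.mem_filter, Finset.mem_powerset, Finset.mem_biUnion,
        Finset.not_disjoint_iff]
      constructor
      · rintro ⟨⟨h1, h2⟩, v, h3, h4⟩
        exact ⟨v, h4, h1, h2, h3⟩
      · rintro ⟨v, h4, h1, h2, h3⟩
        exact ⟨⟨h1, h2⟩, v, h3, h4⟩
    rw [hU, Finset.sum_biUnion, Finset.mul_sum]
    · apply Finset.sum_congr rfl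
      intro v _
      rw [← mul_assoc, Finset.mul_sum]
      refine Finset.sum_bij' (fun S _ => S.erase v) (fun S _ => insert v S) ?_ ?_ ?_ ?_ ?_
      · intro S hS
        simp only [Finset.mem_filter, Finset.mem_powerset] at hS ⊢
        obtain ⟨_, hI, hv⟩ := hS
        refine ⟨?_, ?_⟩
        · intro u hu
          obtain ⟨hne, huS⟩ := Finset.mem_erase.1 hu
          simp only [closedNbhd, Finset.mem_sdiff, Finset.mem_univ, Finset.mem_insert,
            Finset.mem_filter, true_and, not_or]
          exact ⟨hne, hI v hv u huS (Ne.symm hne)⟩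
        · intro a ha b hb
          exact hI a (Finset.mem_of_mem_erase ha) b (Finset.mem_of_mem_erase hb)
      · intro S hS
        simp only [Finset.mem_filter, Finset.mem_powerset] at hS ⊢
        obtain ⟨hsub, hI⟩ := hS
        have hn : ∀ u ∈ S, ¬ G.Adj v u := by
          intro u hu
          have := hsub hu
          simp only [closedNbhd, Finset.mem_sdiff, Finset.mem_univ, Finset.mem_insert,
            Finset.mem_filter, true_and, not_or] at this
          exact this.2
        refine ⟨Finset.subset_univ _, ?_, Finset.mem_insert_self _ _⟩
        intro a ha b hb hab
        rcases Finset.mem_insert.1 ha with rfl | ha2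
        · rcases Finset.mem_insert.1 hb with rfl | hb
          · exact absurd rfl hab
          · exact hn b hb
        · rcases Finset.mem_insert.1 hb with rfl | hb
          · exact fun h => hn a ha2 h.symm
          · exact hI a ha2 b hb hab
      · intro S hS
        exact Finset.insert_erase (Finset.mem_filter.1 hS).2.2
      · intro S hS
        apply Finset.erase_insert
        intro hv
        have := (Finset.mem_powerset.1 (Finset.mem_filter.1 hS).1) hv
        simp [closedNbhd] at this
      · intro S hS
        exact (Finset.mul_prod_erase S (fun u => x * w u) (Finset.mem_filter.1 hS).2.2).symm
    · intro a ha b hb hab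
      simp only [Function.onFun]
      rw [Finset.disjoint_left]
      intro S h1 h2
      have h1 := (Finset.mem_filter.1 h1).2
      have h2 := (Finset.mem_filter.1 h2).2
      exact h1.1 a h1.2 b h2.2 hab (hK a ha b hb hab)
end
end

section
/- Let G be an oriented indifference graph with a fixed oriented perfect elimination ordering, let (h_u)_{u∈V} be a Hamiltonian compatible with G, let χ be a simplicial mode, let ε_l be a single-particle energy, and let N_l be a nonzero complex constant. Then for all p, q ∈ ℤ and all u ∈ ℂ, (1 − u ω^{q−p} ε_l) · T_G(u ω^{−p}) · ψ_{q,l} = (1 − u ω^{q−p+1} ε_l) · ψ_{q,l} · T_G(u ω^{−p}). -/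
noncomputable section
open scoped Classical

/-- `f` is an oriented perfect elimination ordering of the oriented graph `(G, dir)`:
it is an injective labelling of the vertices such that for every vertex the earlier
neighbours form a clique, and every directed edge points forwards. -/
def IsOPEO {V : Type*} (G : SimpleGraph V) (dir : V → V → Prop) (f : V → ℕ) : Prop :=
  Function.Injective f ∧
    (∀ v u w, G.Adj u v → G.Adj w v → f u < f v → f w < f v → u ≠ w → G.Adj u w) ∧
    (∀ u w, dir u w → f u < f w)
/-- `T^{≻p}(u) = ∏_{m=1}^{d−1} T(u·ω^{−p−m})`, factors in increasing order of `m`. -/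
def transferTsucc {V : Type*} [LinearOrder V] {N : ℕ} (d : ℕ) (G : SimpleGraph V)
    (h : V → Matrix (Fin N) (Fin N) ℂ) (A : Finset V) (p : ℤ) (u : ℂ) :
    Matrix (Fin N) (Fin N) ℂ :=
  ((List.range (d - 1)).map (fun m => transferT G h A (u * omegaD d ^ (-(p + (m : ℤ) + 1))))).prod

/-- The parafermionic mode `ψ_{p,k} = (1/N_k) T^p(ε_k⁻¹) χ T^{≻p}(ε_k⁻¹)`. -/
def paraMode {V : Type*} [Fintype V] [LinearOrder V] {N : ℕ} (d : ℕ) (G : SimpleGraph V)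
    (h : V → Matrix (Fin N) (Fin N) ℂ) (χ : Matrix (Fin N) (Fin N) ℂ)
    (ε Nk : ℂ) (p : ℤ) : Matrix (Fin N) (Fin N) ℂ :=
  Nk⁻¹ • (transferT G h Finset.univ (ε⁻¹ * omegaD d ^ (-p)) * χ *
    transferTsucc d G h Finset.univ p ε⁻¹)
/-- neighbour-removed set -/
def nbr {V : Type*} (adj : V → V → Prop) (A : Finset V) (v : V) : Finset V :=
  A.filter (fun w => ¬ adj v w)

/-- `v` is outside `A` and later than all its neighbours in `A` -/
def Late {V : Type*} (adj : V → V → Prop) (f : V → ℕ) (A : Finset V) (v : V) : Prop :=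
  v ∉ A ∧ ∀ w ∈ A, adj v w → f w < f v

/-- abstract data -/
structure Sys {V M : Type*} [DecidableEq V] [Ring M] [Algebra ℂ M] (ω : ℂ) (adj : V → V → Prop) (f : V → ℕ)
    (h : V → M) (T : Finset V → ℂ → M) : Prop where
  symm : ∀ u v, adj u v → adj v u
  irr : ∀ u, ¬ adj u u
  inj : Function.Injective f
  early : ∀ v u w, adj v u → adj v w → f u < f v → f w < f v → u ≠ w → adj u w
  late : ∀ v u w, adj v u → adj v w → f v < f u → f v < f w → u ≠ w → adj u w
  comm : ∀ c v, adj v c → f c < f v → h c * h v = ω • (h v * h c)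
  empty : ∀ x, T ∅ x = 1
  step : ∀ A c x, c ∉ A → T (insert c A) x = T A x - x • (h c * T (nbr adj A c) x)
  free : ∀ A v x, v ∉ A → (∀ w ∈ A, ¬ adj v w) → T A x * h v = h v * T A x

section
variable {V M : Type*} [DecidableEq V] [Ring M] [Algebra ℂ M] {ω : ℂ} {adj : V → V → Prop} {f : V → ℕ}
    {h : V → M} {T : Finset V → ℂ → M}

theorem Sys.split (s : Sys ω adj f h T) {A : Finset V} {v : V} (hA : Late adj f A v) :
    nbr adj A v = A ∨ ∃ c A0, c ∉ A0 ∧ A = insert c A0 ∧ adj v c ∧ f c < f v ∧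
      Late adj f A0 c ∧ Late adj f A0 v ∧ nbr adj A v = nbr adj A0 v ∧
      nbr adj (nbr adj A0 v) c = nbr adj A0 c ∧ Late adj f (nbr adj A0 v) c ∧
      (∀ w ∈ nbr adj A0 c, ¬ adj v w) := by
  by_cases hC : (A.filter (fun w => adj v w)).Nonempty
  · right
    obtain ⟨c, hc, hmax⟩ := Finset.exists_max_image _ f hC
    simp only [Finset.mem_filter] at hc hmax
    obtain ⟨hcA, hvc⟩ := hc
    have hcv := hA.2 c hcA hvc
    have key : ∀ w ∈ A, w ≠ c → adj v w → adj c w := by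
      intro w hw hne hvw
      exact s.early v c w hvc hvw hcv (hA.2 w hw hvw) (Ne.symm hne)
    have hlate : Late adj f (A.erase c) c := by
      refine ⟨by simp, ?_⟩
      intro w hw hcw
      simp only [Finset.mem_erase] at hw
      by_contra hlt
      have h1 : f c < f w := by
        have : f c ≠ f w := fun e => hw.1 (s.inj e).symm
        omega
      have hwv : w ≠ v := fun e => hA.1 (e ▸ hw.2)
      have := s.late c w v hcw (s.symm _ _ hvc) h1 hcv hwv
      have := hmax w ⟨hw.2, s.symm _ _ this⟩
      omega
    refine ⟨c, A.erase c, by simp, (Finset.insert_erase hcA).symm, hvc, hcv, hlate,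
      ⟨fun e => hA.1 (Finset.mem_of_mem_erase e),
        fun w hw => hA.2 w (Finset.mem_of_mem_erase hw)⟩, ?_, ?_, ?_, ?_⟩
    · ext w
      simp only [nbr, Finset.mem_filter, Finset.mem_erase]
      constructor
      · rintro ⟨h1, h2⟩
        exact ⟨⟨fun e => h2 (e ▸ hvc), h1⟩, h2⟩
      · rintro ⟨⟨_, h1⟩, h2⟩
        exact ⟨h1, h2⟩
    · ext w
      simp only [nbr, Finset.mem_filter, Finset.mem_erase]
      constructor
      · rintro ⟨⟨h1, h2⟩, h3⟩
        exact ⟨h1, h3⟩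
      · rintro ⟨h1, h3⟩
        exact ⟨⟨h1, fun e => h3 (key w h1.2 h1.1 e)⟩, h3⟩
    · refine ⟨fun e => hlate.1 (Finset.mem_of_mem_filter _ e),
        fun w hw => hlate.2 w (Finset.mem_of_mem_filter _ hw)⟩
    · intro w hw e
      simp only [nbr, Finset.mem_filter, Finset.mem_erase] at hw
      exact hw.2 (key w hw.1.2 hw.1.1 e)
  · left
    rw [Finset.not_nonempty_iff_eq_empty, Finset.filter_eq_empty_iff] at hC
    rw [nbr, Finset.filter_eq_self]
    intro w hw
    exact hC hw

theorem nbr_card_le (A : Finset V) (v : V) : (nbr adj A v).card ≤ A.card :=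
  Finset.card_filter_le _ _

theorem Sys.free_nbr (s : Sys ω adj f h T) {A : Finset V} {v : V} (hA : Late adj f A v) (x : ℂ) :
    T (nbr adj A v) x * h v = h v * T (nbr adj A v) x :=
  s.free _ _ _ (fun e => hA.1 (Finset.mem_of_mem_filter _ e))
    (fun _ hw => (Finset.mem_filter.1 hw).2)

theorem Sys.L3 (s : Sys ω adj f h T) (n : ℕ) : ∀ (A : Finset V) (v : V), A.card ≤ n →
    Late adj f A v → ∀ x,
    T A x * h v = ω • (h v * T A x) + (1 - ω) • (h v * T (nbr adj A v) x) := by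
  induction n with
  | zero =>
    intro A v hn hA x
    have : A = ∅ := by simpa using hn
    subst this
    have := s.free_nbr hA x
    simp only [nbr, Finset.filter_empty] at this ⊢
    rw [this]; module
  | succ n ih =>
    intro A v hn hA x
    rcases s.split hA with he | ⟨c, A0, hc, rfl, hvc, hcv, l1, l2, e1, e2, l3, hE⟩
    · have := s.free_nbr hA x
      rw [he] at this ⊢
      rw [this]; module
    · rw [Finset.card_insert_of_notMem hc] at hn
      have i := ih A0 v (by omega) l2 x
      rw [e1, s.step _ _ _ hc]
      have g := s.free (nbr adj A0 c) v x (fun e => l2.1 (Finset.mem_of_mem_filter _ e)) hE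
      have k : h c * T (nbr adj A0 c) x * h v = ω • (h v * (h c * T (nbr adj A0 c) x)) := by
        rw [mul_assoc, g, ← mul_assoc, s.comm c v hvc hcv, smul_mul_assoc, mul_assoc]
      rw [sub_mul, smul_mul_assoc, k, i, mul_sub, mul_smul_comm]
      module

/-- the package of commutation relations -/
theorem Sys.main (s : Sys ω adj f h T) (n : ℕ) : ∀ (A : Finset V), A.card ≤ n →
    (∀ x y, T A x * T A y = T A y * T A x) ∧
    (∀ v, Late adj f A v → ∀ x y,
      T A x * T (nbr adj A v) y - T (nbr adj A v) y * T A x =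
      T A y * T (nbr adj A v) x - T (nbr adj A v) x * T A y) ∧
    (∀ v, Late adj f A v → ∀ x y,
      y • (T A x * (h v * T (nbr adj A v) y) - h v * T (nbr adj A v) y * T A x) =
      x • (T A y * (h v * T (nbr adj A v) x) - h v * T (nbr adj A v) x * T A y)) := by
  induction n with
  | zero =>
    intro A hn
    have : A = ∅ := by simpa using hn
    subst this
    simp [nbr, s.empty]
  | succ n ih =>
    intro A hn
    have a : ∀ x y, T A x * T A y = T A y * T A x := by
      rcases A.eq_empty_or_nonempty with rfl | hne
      · simp [s.empty]
      intro x y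
      obtain ⟨v, hv, hmax⟩ := Finset.exists_max_image A f hne
      obtain ⟨A0, hv0, rfl⟩ : ∃ A0, v ∉ A0 ∧ A = insert v A0 :=
        ⟨A.erase v, by simp, (Finset.insert_erase hv).symm⟩
      rw [Finset.card_insert_of_notMem hv0] at hn
      have l : Late adj f A0 v := by
        refine ⟨hv0, fun w hw _ => ?_⟩
        have h1 := hmax w (Finset.mem_insert_of_mem hw)
        have : f w ≠ f v := fun e => hv0 (s.inj e ▸ hw)
        omega
      obtain ⟨i1, i2, i3⟩ := ih A0 (by omega)
      have j1 := (ih (nbr adj A0 v) ((nbr_card_le A0 v).trans (by omega))).1 x y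
      rw [s.step _ _ _ hv0, s.step _ _ _ hv0]
      have k1 := i1 x y
      have k3 := i3 v l x y
      have fx := s.free_nbr l x
      have fy := s.free_nbr l y
      generalize T A0 x = a at *
      generalize T A0 y = a' at *
      generalize T (nbr adj A0 v) x = b at *
      generalize T (nbr adj A0 v) y = b' at *
      have e : h v * b * (h v * b') = h v * b' * (h v * b) := by
        rw [mul_assoc, ← mul_assoc b, fx, mul_assoc, j1, mul_assoc (h v) b', ← mul_assoc b', fy,
          mul_assoc]
      simp only [sub_mul, mul_sub, smul_mul_assoc, mul_smul_comm, smul_smul, smul_sub] at *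
      linear_combination (norm := module) k1 - k3 + (x * y) • e
    have b1 : ∀ v, Late adj f A v → ∀ x y,
      T A x * T (nbr adj A v) y - T (nbr adj A v) y * T A x =
      T A y * T (nbr adj A v) x - T (nbr adj A v) x * T A y := by
      intro v hA x y
      rcases s.split hA with he | ⟨c, A0, hc, rfl, hvc, hcv, l1, l2, e1, e2, l3, hE⟩
      · rw [he, a x y, sub_self]
      · rw [Finset.card_insert_of_notMem hc] at hn
        have i2 := (ih A0 (by omega)).2.1 v l2 x y
        have i3 := (ih (nbr adj A0 v) ((nbr_card_le A0 v).trans (by omega))).2.2 c l3 x y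
        rw [e1, s.step _ _ _ hc, s.step _ _ _ hc]
        rw [e2] at i3
        simp only [sub_mul, mul_sub, smul_mul_assoc, mul_smul_comm, smul_smul, smul_sub] at *
        linear_combination (norm := module) i2 - i3
    refine ⟨a, b1, ?_⟩
    intro v hA x y
    rcases s.split hA with he | ⟨c, A0, hc, rfl, hvc, hcv, l1, l2, e1, e2, l3, hE⟩
    · have fx := s.free_nbr hA x
      have fy := s.free_nbr hA y
      rw [he] at fx fy ⊢
      rw [← mul_assoc, fx, mul_assoc, mul_assoc, a x y, ← mul_assoc (T A y), fy, mul_assoc]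
      simp
    · rw [Finset.card_insert_of_notMem hc] at hn
      have i3 := (ih A0 (by omega)).2.2 v l2 x y
      have hcard := (nbr_card_le (adj := adj) A0 v).trans (by omega : A0.card ≤ n)
      have i2 := (ih (nbr adj A0 v) hcard).2.1 c l3 x y
      have i1 := (ih (nbr adj A0 c) ((nbr_card_le A0 c).trans (by omega))).1 x y
      have gx := s.L3 n (nbr adj A0 v) c hcard l3 x
      have gy := s.L3 n (nbr adj A0 v) c hcard l3 y
      have qx := s.free (nbr adj A0 c) v x (fun e => l2.1 (Finset.mem_of_mem_filter _ e)) hE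
      have qy := s.free (nbr adj A0 c) v y (fun e => l2.1 (Finset.mem_of_mem_filter _ e)) hE
      have hh := s.comm c v hvc hcv
      rw [e1, s.step _ _ _ hc, s.step _ _ _ hc]
      rw [e2] at i2 gx gy
      generalize T A0 x = a at *
      generalize T A0 y = a' at *
      generalize T (nbr adj A0 v) x = b at *
      generalize T (nbr adj A0 v) y = b' at *
      generalize T (nbr adj A0 c) x = e at *
      generalize T (nbr adj A0 c) y = e' at *
      have m1 : ∀ ee bb : M, ee * h v = h v * ee →
          h c * ee * (h v * bb) = ω • (h v * (h c * (ee * bb))) := by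
        intro ee bb hq
        rw [mul_assoc, ← mul_assoc ee, hq, mul_assoc, ← mul_assoc, hh, smul_mul_assoc, mul_assoc]
      have m2 : ∀ ee bb ff : M, bb * h c = ω • (h c * bb) + (1 - ω) • (h c * ff) →
          h v * bb * (h c * ee) = ω • (h v * (h c * (bb * ee))) +
            (1 - ω) • (h v * (h c * (ff * ee))) := by
        intro ee bb ff hq
        rw [mul_assoc, ← mul_assoc bb, hq]
        simp only [add_mul, mul_add, smul_mul_assoc, mul_smul_comm, mul_assoc]
      have r1 := m1 e b' qx
      have r2 := m1 e' b qy
      have r3 := m2 e b' e' gy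
      have r4 := m2 e' b e gx
      have i2' := congrArg (fun z => h v * (h c * z)) i2
      have i1' := congrArg (fun z => h v * (h c * z)) i1
      simp only [sub_mul, mul_sub, smul_mul_assoc, mul_smul_comm, smul_smul, smul_sub] at *
      rw [r1, r2, r3, r4]
      linear_combination (norm := module) i3 - (x*y*ω) • i2' - (x*y*(1-ω)) • i1'
theorem Sys.zero (s : Sys ω adj f h T) (A : Finset V) : T A 0 = 1 := by
  induction A using Finset.induction_on with
  | empty => exact s.empty 0
  | insert c A hc ih => rw [s.step _ _ _ hc, ih]; simp

theorem Sys.relJ (s : Sys ω adj f h T) {A : Finset V} {v : V} (hA : Late adj f A v) (x y : ℂ) :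
    T A x * (h v * T (nbr adj A v) y) - T A y * (h v * T (nbr adj A v) x) =
    ω • (h v * T (nbr adj A v) y * T A x - h v * T (nbr adj A v) x * T A y) := by
  have i1 := (s.main _ (nbr adj A v) le_rfl).1 x y
  have i2 := (s.main _ A le_rfl).2.1 v hA x y
  have gx := s.L3 _ A v le_rfl hA x
  have gy := s.L3 _ A v le_rfl hA y
  generalize T A x = a at *
  generalize T A y = a' at *
  generalize T (nbr adj A v) x = b at *
  generalize T (nbr adj A v) y = b' at *
  have i2' := congrArg (fun z => h v * z) i2
  have i1' := congrArg (fun z => h v * z) i1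
  rw [← mul_assoc, ← mul_assoc, gx, gy]
  simp only [sub_mul, mul_sub, add_mul, smul_mul_assoc, smul_sub, mul_assoc] at *
  linear_combination (norm := module) ω • i2' + (1-ω) • i1'

theorem Sys.relAX (s : Sys ω adj f h T) (hω : ω ≠ 1) {A : Finset V} {v : V}
    (hA : Late adj f A v) (x : ℂ) :
    T A x * (h v * T (nbr adj A v) (x * ω)) = h v * T (nbr adj A v) x * T A (x * ω) := by
  by_cases hx : x = 0
  · subst hx
    simp [s.zero]
  have j := s.relJ hA x (x * ω)
  have i := (s.main _ A le_rfl).2.2 v hA x (x * ω)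
  rw [mul_smul] at i
  have i' := (smul_right_injective M hx) i
  have h1 : (1 - ω) ≠ 0 := sub_ne_zero.2 (Ne.symm hω)
  apply smul_right_injective M h1
  simp only [smul_sub] at *
  linear_combination (norm := module) j - i'

/-- the identity behind the exchange relation -/
theorem Sys.exchange (s : Sys ω adj f h T) (hω : ω ≠ 0) {A : Finset V} {v : V}
    (hA : Late adj f A v) (x y : ℂ) :
    (y - x) • (T (insert v A) x * T (insert v A) y) =
    (y - ω * x) • (T (insert v A) y * (T A x - (ω⁻¹ * x) • (h v * T (nbr adj A v) x))) +
    ((ω - 1) * x) • ((T A x - y • (h v * T (nbr adj A v) x)) *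
      (T A y - (ω⁻¹ * y) • (h v * T (nbr adj A v) y))) := by
  rw [s.step _ _ _ hA.1, s.step _ _ _ hA.1]
  have j := s.relJ hA x y
  obtain ⟨k1, -, k3⟩ := s.main _ A le_rfl
  have k1 := k1 x y
  have k3 := k3 v hA x y
  have j1 := (s.main _ (nbr adj A v) le_rfl).1 x y
  have fx := s.free_nbr hA x
  have fy := s.free_nbr hA y
  generalize T A x = a at *
  generalize T A y = a' at *
  generalize T (nbr adj A v) x = b at *
  generalize T (nbr adj A v) y = b' at *
  have e : h v * b * (h v * b') = h v * b' * (h v * b) := by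
    rw [mul_assoc, ← mul_assoc b, fx, mul_assoc, j1, mul_assoc (h v) b', ← mul_assoc b', fy,
      mul_assoc]
  generalize h v * b = X at *
  generalize h v * b' = X' at *
  simp only [sub_mul, mul_sub, smul_mul_assoc, mul_smul_comm, smul_smul, smul_sub] at *
  rw [e, ← k1]
  have k3' := congrArg (fun z => (y - x) • z) k3
  have j' := congrArg (fun z => (x * y * (1 - ω⁻¹)) • z) j
  simp only [smul_sub, smul_smul] at j' k3'
  linear_combination (norm := skip) -k3' + j'
  match_scalars <;> field_simp <;> ring

end

section
variable {M : Type*} [Ring M] [Algebra ℂ M]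

/-- `X_0 … X_{k-1} A_k … A_{n-1}` -/
def mixProd (A X : ℕ → M) : ℕ → ℕ → M
  | 0, _ => 1
  | n+1, k => if k ≤ n then mixProd A X n k * A n else mixProd A X n n * X n

theorem mixProd_mul (A X : ℕ → M) (hAX : ∀ m, A m * X (m+1) = X m * A (m+1)) (n : ℕ) :
    ∀ k ≤ n, mixProd A X n k * X n = mixProd A X (n+1) (k+1) := by
  induction n with
  | zero => intro k hk; obtain rfl : k = 0 := by omega
            simp [mixProd]
  | succ n ih =>
    intro k hk
    rcases Nat.lt_or_ge n k with hlt | hle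
    · obtain rfl : k = n + 1 := by omega
      conv_rhs => rw [mixProd, if_neg (by omega)]
    · conv_rhs => rw [mixProd, if_pos (by omega), ← ih k hle]
      rw [mixProd, if_pos hle, mul_assoc, mul_assoc, hAX]

theorem mixProd_zero (A X : ℕ → M) (n : ℕ) :
    mixProd A X n 0 = ((List.range n).map A).prod := by
  induction n with
  | zero => simp [mixProd]
  | succ n ih => simp [mixProd, ih, List.range_succ]

theorem mixProd_self (A X : ℕ → M) (n : ℕ) :
    mixProd A X n n = ((List.range n).map X).prod := by
  induction n with
  | zero => simp [mixProd]
  | succ n ih => simp [mixProd, ih, List.range_succ]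

open Polynomial in
theorem prod_mix (A X : ℕ → M) (hAX : ∀ m, A m * X (m+1) = X m * A (m+1)) (t : ℕ → ℂ) (n : ℕ) :
    (∏ m ∈ Finset.range n, ((1 : ℂ[X]) - C (t m) * Polynomial.X)).natDegree ≤ n ∧
    ((List.range n).map (fun m => A m - t m • X m)).prod =
      ∑ k ∈ Finset.range (n+1),
        (∏ m ∈ Finset.range n, ((1 : ℂ[X]) - C (t m) * Polynomial.X)).coeff k
          • mixProd A X n k := by
  induction n with
  | zero => simp [mixProd]
  | succ n ih =>
    obtain ⟨ih1, ih2⟩ := ih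
    rw [List.range_succ, List.map_append, List.prod_append, ih2, Finset.prod_range_succ]
    set p := ∏ m ∈ Finset.range n, ((1 : ℂ[X]) - C (t m) * Polynomial.X)
    constructor
    · refine natDegree_mul_le.trans (Nat.add_le_add ih1 ?_)
      compute_degree
    · have e : ∀ k, (p * (1 - C (t n) * Polynomial.X)).coeff k =
          p.coeff k - t n * (p * Polynomial.X).coeff k := by
        intro k
        rw [mul_sub, mul_one, coeff_sub, ← coeff_C_mul]
        congr 2; ring
      simp only [e, sub_smul, Finset.sum_sub_distrib]
      rw [Finset.sum_range_succ (fun k => p.coeff k • mixProd A X (n+1) k) (n+1),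
        coeff_eq_zero_of_natDegree_lt (Nat.lt_succ_of_le ih1)]
      rw [Finset.sum_range_succ' (fun k : ℕ =>
        (t n * (p * (Polynomial.X : ℂ[X])).coeff k) • mixProd A X (n+1) k) (n+1)]
      simp only [coeff_mul_X, List.map_cons, List.map_nil, List.prod_cons, List.prod_nil, mul_one,
        mul_coeff_zero, coeff_X_zero, mul_zero, zero_smul, add_zero, mul_sub, Finset.sum_mul,
        smul_mul_assoc, mul_smul_comm]
      congr 1
      · apply Finset.sum_congr rfl
        intro k hk
        rw [mixProd, if_pos (by simpa [Nat.lt_succ_iff] using hk)]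
      · rw [Finset.smul_sum]
        apply Finset.sum_congr rfl
        intro k hk
        rw [mixProd_mul A X hAX n k (by simpa [Nat.lt_succ_iff] using hk), smul_smul]

open Polynomial in
theorem prod_range_root {d : ℕ} (hd : 0 < d) {ω : ℂ} (hω : IsPrimitiveRoot ω d) (x : ℂ) :
    ∏ m ∈ Finset.range d, ((1 : ℂ[X]) - C (x * ω ^ m) * Polynomial.X) =
      1 - C (x ^ d) * Polynomial.X ^ d := by
  have hp : IsPrimitiveRoot (C ω : ℂ[X]) d := hω.map_of_injective (C_injective)
  have := hp.pow_sub_pow_eq_prod_sub_mul (1 : ℂ[X]) (C x * Polynomial.X) hd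
  rw [one_pow, mul_pow, ← C_pow] at this
  rw [this]
  refine Finset.prod_bij (fun m _ => (C ω) ^ m) ?_ ?_ ?_ ?_
  · intro m _
    rw [mem_nthRootsFinset hd, ← pow_mul, mul_comm, pow_mul, hp.pow_eq_one, one_pow]
  · intro m hm m' hm' e
    exact hp.pow_inj (Finset.mem_range.1 hm) (Finset.mem_range.1 hm') e
  · intro z hz
    rw [mem_nthRootsFinset hd] at hz
    have : NeZero d := ⟨hd.ne'⟩
    obtain ⟨i, hi, e⟩ := hp.eq_pow_of_pow_eq_one hz
    exact ⟨i, Finset.mem_range.2 hi, e⟩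
  · intro m _
    simp only [C_mul, C_pow]
    ring

theorem prod_roots {d : ℕ} (hd : 0 < d) {ω : ℂ} (hω : IsPrimitiveRoot ω d) (x : ℂ)
    (A X : ℕ → M) (hAX : ∀ m, A m * X (m+1) = X m * A (m+1)) :
    ((List.range d).map (fun m => A m - (x * ω ^ m) • X m)).prod =
      ((List.range d).map A).prod - x ^ d • ((List.range d).map X).prod := by
  rw [(prod_mix A X hAX (fun m => x * ω ^ m) d).2, prod_range_root hd hω,
    ← mixProd_zero A X, ← mixProd_self A X]
  obtain ⟨e, rfl⟩ : ∃ e, d = e + 1 := ⟨d - 1, by omega⟩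
  rw [Finset.sum_range_succ, Finset.sum_range_succ']
  rw [Finset.sum_eq_zero]
  · simp [Polynomial.coeff_one, Polynomial.coeff_X_pow, -map_pow]
    module
  · intro k hk
    simp at hk
    rw [Polynomial.coeff_sub, Polynomial.coeff_C_mul, Polynomial.coeff_X_pow, Polynomial.coeff_one]
    rw [if_neg (by omega), if_neg (by omega)]
    simp

end
theorem prod_hB {M : Type*} [Ring M] (a : M) (B : ℕ → M) (hc : ∀ m, B m * a = a * B m) (n : ℕ) :
    ((List.range n).map (fun m => a * B m)).prod = a ^ n * ((List.range n).map B).prod := by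
  induction n with
  | zero => simp
  | succ n ih =>
    have : Commute ((List.range n).map B).prod a := by
      apply Commute.list_prod_left
      intro z hz
      obtain ⟨m, _, rfl⟩ := List.mem_map.1 hz
      exact hc m
    rw [List.range_succ, List.map_append, List.prod_append, ih, List.map_append, List.prod_append]
    simp only [List.map_cons, List.map_nil, List.prod_cons, List.prod_nil, mul_one]
    rw [mul_assoc, ← mul_assoc _ a, this.eq, pow_succ]
    simp only [mul_assoc]

theorem Sys.prodT {V M : Type*} [DecidableEq V] [Ring M] [Algebra ℂ M] {ω : ℂ}
    {adj : V → V → Prop} {f : V → ℕ} {h : V → M} {T : Finset V → ℂ → M}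
    (s : Sys ω adj f h T) {d : ℕ} (hd : 0 < d) (hω : IsPrimitiveRoot ω d) (hω1 : ω ≠ 1)
    (β : V → ℂ) (hpow : ∀ v, h v ^ d = β v • (1 : M)) (x : ℂ) (Z : Finset V → ℂ)
    (hZ0 : Z ∅ = 1)
    (hZ : ∀ A c, c ∉ A → Z (insert c A) = Z A - x ^ d * β c * Z (nbr adj A c)) (n : ℕ) :
    ∀ A : Finset V, A.card ≤ n →
      ((List.range d).map (fun m => T A (x * ω ^ m))).prod = Z A • (1 : M) := by
  induction n with
  | zero =>
    intro A hn
    have : A = ∅ := by simpa using hn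
    subst this
    simp [s.empty, hZ0]
  | succ n ih =>
    intro A hn
    rcases A.eq_empty_or_nonempty with rfl | hne
    · simp [s.empty, hZ0]
    obtain ⟨v, hv, hmax⟩ := Finset.exists_max_image A f hne
    obtain ⟨A0, hv0, rfl⟩ : ∃ A0, v ∉ A0 ∧ A = insert v A0 :=
      ⟨A.erase v, by simp, (Finset.insert_erase hv).symm⟩
    rw [Finset.card_insert_of_notMem hv0] at hn
    have l : Late adj f A0 v := by
      refine ⟨hv0, fun w hw _ => ?_⟩
      have h1 := hmax w (Finset.mem_insert_of_mem hw)
      have : f w ≠ f v := fun e => hv0 (s.inj e ▸ hw)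
      omega
    simp only [s.step _ _ _ hv0]
    rw [prod_roots hd hω x (fun m => T A0 (x * ω ^ m))
      (fun m => h v * T (nbr adj A0 v) (x * ω ^ m)), prod_hB (h v), ih A0 (by omega),
      ih (nbr adj A0 v) ((nbr_card_le A0 v).trans (by omega)), hpow, hZ _ _ hv0]
    · simp only [smul_mul_smul_comm, mul_one]
      module
    · intro m
      exact s.free_nbr l _
    · intro m
      have := s.relAX hω1 l (x * ω ^ m)
      rwa [mul_assoc, ← pow_succ] at this

section
variable {V : Type*} [LinearOrder V] {N : ℕ} (G : SimpleGraph V)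
  (h : V → Matrix (Fin N) (Fin N) ℂ)

theorem transferT_eq (A : Finset V) (x : ℂ) :
    transferT G h A x = ∑ S ∈ A.powerset.filter (fun S => IsIndep G S),
      (-x) ^ S.card • hProd h S := by
  rw [transferT, ← Finset.sum_fiberwise_of_maps_to (t := Finset.range (indepNum G A + 1))
    (g := Finset.card)]
  · apply Finset.sum_congr rfl
    intro k _
    rw [chargeQ, Finset.smul_sum, Finset.filter_filter]
    apply Finset.sum_congr rfl
    intro S hS
    rw [(Finset.mem_filter.1 hS).2.2]
  · intro S hS
    rw [Finset.mem_range, Nat.lt_succ_iff]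
    exact Finset.le_sup (f := Finset.card) hS

theorem indep_sum {R : Type*} [AddCommMonoid R] (g : Finset V → R) (A : Finset V) (c : V)
    (hc : c ∉ A) :
    ∑ S ∈ (insert c A).powerset.filter (fun S => IsIndep G S), g S =
    ∑ S ∈ A.powerset.filter (fun S => IsIndep G S), g S +
    ∑ S ∈ (nbr G.Adj A c).powerset.filter (fun S => IsIndep G S), g (insert c S) := by
  rw [Finset.sum_filter, Finset.sum_powerset_insert hc, ← Finset.sum_filter, ← Finset.sum_filter]
  congr 1
  apply Finset.sum_congr _ (fun _ _ => rfl)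
  ext S
  simp only [Finset.mem_filter, Finset.mem_powerset, nbr]
  constructor
  · rintro ⟨h1, h2⟩
    refine ⟨fun w hw => ?_, fun u hu w hw => h2 u (by simp [hu]) w (by simp [hw])⟩
    rw [Finset.mem_filter]
    exact ⟨h1 hw, h2 c (by simp) w (by simp [hw]) (fun e => hc (e ▸ h1 hw))⟩
  · rintro ⟨h1, h2⟩
    refine ⟨fun w hw => (Finset.mem_filter.1 (h1 hw)).1, ?_⟩
    intro u hu w hw hne
    rcases Finset.mem_insert.1 hu with rfl | hu2
    · rcases Finset.mem_insert.1 hw with rfl | hw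
      · exact absurd rfl hne
      · exact (Finset.mem_filter.1 (h1 hw)).2
    · rcases Finset.mem_insert.1 hw with rfl | hw
      · exact fun e => (Finset.mem_filter.1 (h1 hu2)).2 e.symm
      · exact h2 u hu2 w hw hne

theorem commute_hProd (S : Finset V) (a : Matrix (Fin N) (Fin N) ℂ)
    (ha : ∀ w ∈ S, h w * a = a * h w) : hProd h S * a = a * hProd h S := by
  apply Commute.list_prod_left
  intro z hz
  obtain ⟨m, hm, rfl⟩ := List.mem_map.1 hz
  exact ha m (by simpa using hm)

theorem commute_transferT (A : Finset V) (a : Matrix (Fin N) (Fin N) ℂ)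
    (ha : ∀ w ∈ A, h w * a = a * h w) (x : ℂ) :
    transferT G h A x * a = a * transferT G h A x := by
  rw [transferT_eq, Finset.sum_mul, Finset.mul_sum]
  apply Finset.sum_congr rfl
  intro S hS
  rw [smul_mul_assoc, mul_smul_comm, commute_hProd h S a]
  intro w hw
  exact ha w (Finset.mem_powerset.1 (Finset.mem_filter.1 hS).1 hw)

theorem hProd_insert (hcn : ∀ u w, u ≠ w → ¬ G.Adj u w → h u * h w = h w * h u)
    (S : Finset V) (c : V) (hc : c ∉ S) (hS : IsIndep G S)
    (hcS : ∀ w ∈ S, ¬ G.Adj c w) : hProd h (insert c S) = h c * hProd h S := by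
  have hcomm : ∀ u ∈ insert c S, ∀ w ∈ insert c S, Commute (h u) (h w) := by
    intro u hu w hw
    by_cases e : u = w
    · rw [e]
    apply hcn u w e
    rcases Finset.mem_insert.1 hu with rfl | hu2
    · rcases Finset.mem_insert.1 hw with rfl | hw
      · exact absurd rfl e
      · exact hcS w hw
    · rcases Finset.mem_insert.1 hw with rfl | hw
      · exact fun e => hcS u hu2 e.symm
      · exact hS u hu2 w hw e
  have hp : ((insert c S).sort (· ≤ ·)).Perm (c :: S.sort (· ≤ ·)) := by
    rw [List.perm_ext_iff_of_nodup (Finset.sort_nodup _ _)]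
    · intro a; simp
    · rw [List.nodup_cons]
      exact ⟨by simpa using hc, Finset.sort_nodup _ _⟩
  rw [hProd, hProd, (hp.map h).prod_eq', List.map_cons, List.prod_cons]
  rw [List.pairwise_map]
  apply List.Pairwise.imp_of_mem (R := fun _ _ => True)
  · intro a b ha hb _
    exact hcomm a (by simpa using ha) b (by simpa using hb)
  · exact List.pairwise_of_forall (fun _ _ => trivial)

theorem transferT_step (hcn : ∀ u w, u ≠ w → ¬ G.Adj u w → h u * h w = h w * h u)
    (A : Finset V) (c : V) (x : ℂ) (hc : c ∉ A) :
    transferT G h (insert c A) x =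
      transferT G h A x - x • (h c * transferT G h (nbr G.Adj A c) x) := by
  rw [transferT_eq, indep_sum G _ A c hc, transferT_eq, transferT_eq, sub_eq_add_neg]
  congr 1
  rw [Finset.mul_sum, Finset.smul_sum, ← Finset.sum_neg_distrib]
  apply Finset.sum_congr rfl
  intro S hS
  simp only [Finset.mem_filter, Finset.mem_powerset] at hS
  have hcS : c ∉ S := fun e => hc (Finset.mem_filter.1 (hS.1 e)).1
  rw [hProd_insert G h hcn S c hcS hS.2 (fun w hw => (Finset.mem_filter.1 (hS.1 hw)).2),
    Finset.card_insert_of_notMem hcS, mul_smul_comm, smul_smul, ← neg_smul]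
  congr 1
  ring

theorem transferT_empty (x : ℂ) : transferT G h ∅ x = 1 := by
  have : IsIndep G (∅ : Finset V) := by simp [IsIndep]
  rw [transferT_eq, Finset.powerset_empty, Finset.filter_singleton, if_pos this]
  simp [hProd]

theorem indepPoly_step (w : V → ℂ) (A : Finset V) (c : V) (x : ℂ) (hc : c ∉ A) :
    indepPoly G w (insert c A) x = indepPoly G w A x + x * w c * indepPoly G w (nbr G.Adj A c) x := by
  rw [indepPoly, indep_sum G _ A c hc, indepPoly, indepPoly, Finset.mul_sum]
  congr 1
  apply Finset.sum_congr rfl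
  intro S hS
  simp only [Finset.mem_filter, Finset.mem_powerset] at hS
  have hcS : c ∉ S := fun e => hc (Finset.mem_filter.1 (hS.1 e)).1
  rw [Finset.prod_insert hcS]

theorem indepPoly_empty (w : V → ℂ) (x : ℂ) : indepPoly G w ∅ x = 1 := by
  have : IsIndep G (∅ : Finset V) := by simp [IsIndep]
  rw [indepPoly, Finset.powerset_empty, Finset.filter_singleton, if_pos this]
  simp

end

theorem omegaD_prim (d : ℕ) (hd : 2 ≤ d) : IsPrimitiveRoot (omegaD d) d :=
  Complex.isPrimitiveRoot_exp d (by omega)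

theorem late_clique {V : Type*} (G : SimpleGraph V) (dir : V → V → Prop)
    (hdir' : ∀ u v, G.Adj u v → (dir u v ↔ ¬ dir v u))
    (hdip : DipathOriented G dir) (v u w : V) (hu : dir v u) (hw : dir v w)
    (au : G.Adj v u) (aw : G.Adj v w)
    (hne : u ≠ w) : G.Adj u w := by
  by_contra hn
  have hn' : ¬ G.Adj w u := fun e => hn e.symm
  have := hdip 2 ![u, v, w] ⟨by
    intro i j
    have h1 := au.ne
    have h2 := aw.ne
    fin_cases i <;> fin_cases j <;> simp [hne, hne.symm, h1, h1.symm, h2, h2.symm], by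
    intro i j
    fin_cases i <;> fin_cases j <;> simp [au, aw, au.symm, aw.symm, hn, hn']⟩
  rcases this with h1 | h1
  · have := h1 0
    simp at this
    exact (hdir' _ _ au).1 hu this
  · have := h1 1
    simp at this
    exact (hdir' _ _ aw).1 hw this
/-- exchange relation between the transfer operator and a parafermionic mode. -/
theorem transfer_paraMode_commutator
    {V : Type*} [Fintype V] [LinearOrder V] {N : ℕ}
    (d : ℕ) (hd : 2 ≤ d)
    (G : SimpleGraph V) (dir : V → V → Prop)
    (hdir : ∀ u v, dir u v → G.Adj u v)
    (hdir' : ∀ u v, G.Adj u v → (dir u v ↔ ¬ dir v u))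
    (hdip : DipathOriented G dir)
    (f : V → ℕ) (hopeo : IsOPEO G dir f)
    (v : V) (hlast : ∀ u, u ≠ v → f u < f v)
    (h : V → Matrix (Fin N) (Fin N) ℂ) (b : V → ℝ)
    (hb : ∀ w, b w ≠ 0)
    (hpow : ∀ w, h w ^ d = ((b w : ℂ) ^ d) • (1 : Matrix (Fin N) (Fin N) ℂ))
    (hcd : ∀ u w, dir u w → h u * h w = omegaD d • (h w * h u))
    (hcn : ∀ u w, u ≠ w → ¬ G.Adj u w → h u * h w = h w * h u)
    (χ : Matrix (Fin N) (Fin N) ℂ) (hχ : IsUnit χ)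
    (hχcomm : ∀ u, u ≠ v → χ * h u = h u * χ)
    (hχv : h v * χ = omegaD d • (χ * h v))
    (εl : ℂ) (hε : εl ≠ 0)
    (hZ : indepPoly G (fun w => (b w : ℂ) ^ d) Finset.univ (-(εl ^ (-(d : ℤ)))) = 0)
    (Nl : ℂ) (hN : Nl ≠ 0) :
    ∀ (p q : ℤ) (u : ℂ),
      (1 - u * omegaD d ^ (q - p) * εl) •
          (transferT G h Finset.univ (u * omegaD d ^ (-p)) * paraMode d G h χ εl Nl q) =
        (1 - u * omegaD d ^ (q - p + 1) * εl) •
          (paraMode d G h χ εl Nl q * transferT G h Finset.univ (u * omegaD d ^ (-p))) := by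
  intro p q u
  have hprim := omegaD_prim d hd
  have hω1 : omegaD d ≠ 1 := hprim.ne_one (by omega)
  have hω0 : omegaD d ≠ 0 := hprim.ne_zero (by omega)
  have hori : ∀ a c, G.Adj a c → f a < f c → dir a c := by
    intro a c hac hlt
    rw [hdir' a c hac]
    intro e
    have := hopeo.2.2 _ _ e
    omega
  have s : Sys (omegaD d) G.Adj f h (transferT G h) :=
    { symm := fun _ _ e => e.symm
      irr := fun _ => G.irrefl
      inj := hopeo.1
      early := fun a b c hb hc h1 h2 hne => hopeo.2.1 a b c hb.symm hc.symm h1 h2 hne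
      late := fun a b c hb hc h1 h2 hne =>
        late_clique G dir hdir' hdip a b c (hori _ _ hb h1) (hori _ _ hc h2) hb hc hne
      comm := fun a c hac hlt => hcd a c (hori a c hac.symm hlt)
      empty := transferT_empty G h
      step := transferT_step G h hcn
      free := fun A a x ha hA => commute_transferT G h A (h a)
        (fun w hw => hcn w a (fun e => ha (e ▸ hw)) (fun e => hA w hw e.symm)) x }
  obtain ⟨A, hvA, hA⟩ : ∃ A : Finset V, v ∉ A ∧ insert v A = Finset.univ :=
    ⟨Finset.univ.erase v, by simp, Finset.insert_erase (Finset.mem_univ v)⟩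
  have l : Late G.Adj f A v := ⟨hvA, fun w hw _ => hlast w (fun e => hvA (e ▸ hw))⟩
  generalize hω : omegaD d = ω at *
  have hcomm := (s.main _ Finset.univ le_rfl).1
  -- vanishing of the full product
  have hprod0 : ∀ x : ℂ, x ^ d = εl ^ (-(d : ℤ)) →
      ((List.range d).map (fun m => transferT G h Finset.univ (x * ω ^ m))).prod = 0 := by
    intro x hx
    rw [s.prodT (by omega) hprim hω1 (fun w => (b w : ℂ) ^ d) hpow x
      (fun A => indepPoly G (fun w => (b w : ℂ) ^ d) A (-(x ^ d))) (indepPoly_empty G _ _)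
      (fun A c hc => by simp only [indepPoly_step G _ A c _ hc]; ring) _ Finset.univ le_rfl]
    simp only [hx, hZ, zero_smul]
  have hvan : transferT G h Finset.univ (εl⁻¹ * ω ^ (-q)) *
      transferTsucc d G h Finset.univ q εl⁻¹ = 0 := by
    have e1 : transferT G h Finset.univ (εl⁻¹ * ω ^ (-q)) *
        transferTsucc d G h Finset.univ q εl⁻¹ =
        ((List.range d).map
          (fun m : ℕ => transferT G h Finset.univ (εl⁻¹ * ω ^ (-(q + (m : ℤ)))))).prod := by
      obtain ⟨e, rfl⟩ : ∃ e, d = e + 1 := ⟨d - 1, by omega⟩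
      rw [List.range_succ_eq_map, List.map_cons, List.prod_cons, transferTsucc, hω, List.map_map]
      simp [Function.comp_def, add_assoc]
      rw [← List.map_eq_flatMap, List.map_map]
      rfl
    have e2 : ((List.range d).map (fun m => d - 1 - m)).Perm (List.range d) := by
      rw [List.perm_ext_iff_of_nodup _ List.nodup_range]
      · intro a
        simp only [List.mem_map, List.mem_range]
        constructor
        · rintro ⟨c, _, rfl⟩; omega
        · intro ha; exact ⟨d - 1 - a, by omega, by omega⟩
      · apply List.Nodup.map_on _ List.nodup_range
        intro a ha c hc e
        simp only [List.mem_range] at ha hc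
        omega
    have e3 := e2.map
      (fun m : ℕ => transferT G h Finset.univ (εl⁻¹ * ω ^ (-(q + (m : ℤ)))))
    rw [e1, ← e3.prod_eq']
    · rw [← hprod0 (εl⁻¹ * ω ^ (-(q + (d : ℤ) - 1)))]
      · rw [List.map_map]
        congr 1
        apply List.map_congr_left
        intro m hm
        rw [List.mem_range] at hm
        simp only [Function.comp_apply]
        rw [mul_assoc, ← zpow_natCast ω m, ← zpow_add₀ hω0]
        congr 3
        rw [Nat.cast_sub (by omega), Nat.cast_sub (by omega)]
        push_cast
        ring
      · rw [mul_pow, ← zpow_natCast (ω ^ _), ← zpow_mul, mul_comm _ (d : ℤ), zpow_mul,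
          zpow_natCast ω d, hprim.pow_eq_one, one_zpow, mul_one, zpow_neg, zpow_natCast, inv_pow]
    · rw [List.pairwise_map]
      exact List.pairwise_of_forall (fun _ _ => hcomm _ _)
  have hR : Commute (transferTsucc d G h Finset.univ q εl⁻¹)
      (transferT G h Finset.univ (u * ω ^ (-p))) := by
    apply Commute.list_prod_left
    intro z hz
    obtain ⟨m, _, rfl⟩ := List.mem_map.1 hz
    exact hcomm _ _
  -- moving the simplicial mode through
  have hχT : ∀ x, χ * transferT G h Finset.univ x =
      (transferT G h A x - (ω⁻¹ * x) • (h v * transferT G h (nbr G.Adj A v) x)) * χ := by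
    intro x
    have c1 := commute_transferT G h A χ
      (fun w hw => (hχcomm w (fun e => hvA (e ▸ hw))).symm) x
    have c2 := commute_transferT G h (nbr G.Adj A v) χ
      (fun w hw => (hχcomm w (fun e => hvA (e ▸ (Finset.mem_filter.1 hw).1))).symm) x
    rw [← hA, s.step _ _ _ hvA, mul_sub, sub_mul, c1, mul_smul_comm, smul_mul_assoc, mul_assoc (h v),
      c2, ← mul_assoc (h v), hχv, smul_mul_assoc, smul_smul, mul_assoc]
    congr 2
    · field_simp
    · rw [mul_assoc]
  have ex := s.exchange hω0 l (u * ω ^ (-p)) (εl⁻¹ * ω ^ (-q))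
  rw [hA] at ex
  have k1 : (1 - u * ω ^ (q - p) * εl) =
      (εl * ω ^ q) * (εl⁻¹ * ω ^ (-q) - u * ω ^ (-p)) := by
    rw [zpow_sub₀ hω0, zpow_neg, zpow_neg]
    field_simp
  have k2 : (1 - u * ω ^ (q - p + 1) * εl) =
      (εl * ω ^ q) * (εl⁻¹ * ω ^ (-q) - ω * (u * ω ^ (-p))) := by
    rw [zpow_add_one₀ hω0, zpow_sub₀ hω0, zpow_neg, zpow_neg]
    field_simp
  rw [k1, k2, paraMode, hω]
  generalize u * ω ^ (-p) = x at *
  generalize εl⁻¹ * ω ^ (-q) = y at *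
  have hx := hχT x
  have hy := hχT y
  generalize transferTsucc d G h Finset.univ q εl⁻¹ = R at *
  generalize transferT G h A x - (ω⁻¹ * x) • (h v * transferT G h (nbr G.Adj A v) x) = Tx at *
  generalize transferT G h A y - (ω⁻¹ * y) • (h v * transferT G h (nbr G.Adj A v) y) = Ty at *
  generalize transferT G h A x - y • (h v * transferT G h (nbr G.Adj A v) x) = D at *
  generalize transferT G h Finset.univ x = X at *
  generalize transferT G h Finset.univ y = Y at *
  have z1 : Ty * χ * R = 0 := by rw [← hy, mul_assoc, hvan, mul_zero]
  have z2 : Tx * χ * R = χ * R * X := by rw [← hx, mul_assoc, ← hR.eq, mul_assoc]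
  have fin := congrArg (fun z => z * (χ * R)) ex
  simp only [add_mul, smul_mul_assoc] at fin
  have w1 : D * Ty * (χ * R) = 0 := by rw [mul_assoc, ← mul_assoc Ty, z1, mul_zero]
  have w2 : Y * Tx * (χ * R) = Y * χ * R * X := by
    rw [mul_assoc, ← mul_assoc Tx, z2]
    simp only [mul_assoc]
  rw [w1, w2, smul_zero, add_zero] at fin
  have fin2 := congrArg (fun z => (εl * ω ^ q * Nl⁻¹) • z) fin
  simp only [mul_smul_comm, smul_mul_assoc, smul_smul, mul_assoc] at fin2 ⊢
  convert fin2 using 2 <;> ring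
end
end

section
/- Let G be an oriented indifference graph with a fixed oriented perfect elimination ordering, let (h_u)_{u∈V} be a Hamiltonian compatible with G, let χ be a simplicial mode, let ε_l be a single-particle energy, and let N_l be a nonzero complex constant. Then for all q ∈ ℤ, (1+ω) · χ · ψ_{q,l} = (1/N_l) · T_G^q(ε_l^{−1}) · χ² · T_G^{≻q}(ε_l^{−1}). -/
noncomputable section
open scoped Classical

/-- Ordered product in an arbitrary monoid. -/
def gProd {V : Type*} [LinearOrder V] {R : Type*} [Monoid R] (g : V → R) (S : Finset V) : R :=
  ((S.sort (· ≤ ·)).map g).prod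

/-- Sum over independent subsets of the ordered products. -/
def indepSum {V : Type*} [LinearOrder V] {R : Type*} [Semiring R] (G : SimpleGraph V)
    (g : V → R) (A : Finset V) : R :=
  ∑ S ∈ A.powerset.filter (fun S => IsIndep G S), gProd g S

theorem gProd_insert {V : Type*} [LinearOrder V] {R : Type*} [Monoid R] (G : SimpleGraph V)
    (g : V → R) (hg : ∀ u w, u ≠ w → ¬ G.Adj u w → g u * g w = g w * g u)
    (v : V) (S : Finset V) (hv : v ∉ S) (hS : IsIndep G (insert v S)) :
    gProd g (insert v S) = g v * gProd g S := by
  unfold gProd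
  have hperm : ((insert v S).sort (· ≤ ·)).Perm (v :: S.sort (· ≤ ·)) := by
    rw [List.perm_ext_iff_of_nodup (Finset.sort_nodup _ _)]
    · intro a; simp
    · simp [hv]
  rw [← List.prod_cons, ← List.map_cons]
  apply List.Perm.prod_eq' (hperm.map g)
  rw [List.pairwise_map]
  apply List.Pairwise.imp_of_mem _ (Finset.sort_nodup _ _)
  intro a b ha hb hab
  rw [Finset.mem_sort] at ha hb
  exact hg a b hab (hS a ha b hb hab)

theorem IsIndep.mono {V : Type*} {G : SimpleGraph V} {S T : Finset V} (h : IsIndep G T)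
    (hST : S ⊆ T) : IsIndep G S := fun u hu w hw => h u (hST hu) w (hST hw)

theorem gProd_congr {V : Type*} [LinearOrder V] {R : Type*} [Monoid R]
    (g g' : V → R) (S : Finset V) (h : ∀ u ∈ S, g u = g' u) : gProd g S = gProd g' S := by
  unfold gProd
  congr 1
  apply List.map_congr_left
  intro a ha
  exact h a (by simpa using ha)

theorem gProd_smul {V : Type*} [LinearOrder V] {R : Type*} [Ring R] [Algebra ℂ R]
    (g : V → R) (c : ℂ) (S : Finset V) : gProd (fun u => c • g u) S = c ^ S.card • gProd g S := by
  unfold gProd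
  rw [← Finset.length_sort (s := S) (· ≤ ·)]
  generalize S.sort (· ≤ ·) = l
  induction l with
  | nil => simp
  | cons a l ih => simp only [List.map_cons, List.prod_cons, ih, List.length_cons,
      smul_mul_smul_comm, pow_succ']

theorem gProd_commute {V : Type*} [LinearOrder V] {R : Type*} [Monoid R]
    (g : V → R) (y : R) (S : Finset V) (h : ∀ u ∈ S, g u * y = y * g u) :
    gProd g S * y = y * gProd g S := by
  have : Commute (gProd g S) y := by
    unfold gProd
    apply Commute.list_prod_left
    intro a ha
    simp only [List.mem_map, Finset.mem_sort] at ha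
    obtain ⟨u, hu, rfl⟩ := ha
    exact h u hu
  exact this

theorem indepSum_insert {V : Type*} [LinearOrder V] {R : Type*} [Ring R] (G : SimpleGraph V)
    (g : V → R) (hg : ∀ u w, u ≠ w → ¬ G.Adj u w → g u * g w = g w * g u)
    (v : V) (s : Finset V) (hv : v ∉ s) :
    indepSum G g (insert v s) =
      indepSum G g s + g v * indepSum G g (s.filter (fun u => ¬ G.Adj v u)) := by
  unfold indepSum
  rw [← Finset.sum_filter_add_sum_filter_not _ (fun S => v ∉ S), Finset.mul_sum]
  congr 1
  · apply Finset.sum_congr _ (fun _ _ => rfl)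
    ext S
    simp only [Finset.mem_filter, Finset.mem_powerset]
    constructor
    · rintro ⟨⟨h1, h2⟩, h3⟩
      exact ⟨(Finset.subset_insert_iff_of_notMem h3).1 h1, h2⟩
    · rintro ⟨h1, h2⟩
      exact ⟨⟨h1.trans (Finset.subset_insert _ _), h2⟩, fun h => hv (h1 h)⟩
  · symm
    refine Finset.sum_bij' (fun S _ => insert v S) (fun S _ => S.erase v) ?_ ?_ ?_ ?_ ?_
    · intro S hS
      simp only [Finset.mem_filter, Finset.mem_powerset] at hS ⊢
      obtain ⟨h1, h2⟩ := hS
      have h3 : ∀ u ∈ S, u ∈ s ∧ ¬ G.Adj v u := fun u hu => by simpa using h1 hu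
      refine ⟨⟨Finset.insert_subset_insert _ (fun u hu => (h3 u hu).1), ?_⟩, by simp⟩
      intro a ha b hb hab
      rw [Finset.mem_insert] at ha hb
      rcases ha with rfl | ha <;> rcases hb with rfl | hb
      · exact absurd rfl hab
      · exact (h3 b hb).2
      · exact fun h => (h3 a ha).2 h.symm
      · exact h2 a ha b hb hab
    · intro S hS
      simp only [Finset.mem_filter, Finset.mem_powerset, not_not] at hS ⊢
      obtain ⟨⟨h1, h2⟩, h3⟩ := hS
      refine ⟨?_, h2.mono (Finset.erase_subset _ _)⟩
      intro u hu
      rw [Finset.mem_erase] at hu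
      rw [Finset.mem_filter]
      exact ⟨(Finset.mem_insert.1 (h1 hu.2)).resolve_left hu.1, h2 v h3 u hu.2 (Ne.symm hu.1)⟩
    · intro S hS
      simp only [Finset.mem_filter, Finset.mem_powerset] at hS
      exact Finset.erase_insert (fun h => hv (Finset.mem_filter.1 (hS.1 h)).1)
    · intro S hS
      simp only [Finset.mem_filter, not_not] at hS
      exact Finset.insert_erase hS.2
    · intro S hS
      simp only [Finset.mem_filter, Finset.mem_powerset] at hS
      obtain ⟨h1, h2⟩ := hS
      have h3 : ∀ u ∈ S, u ∈ s ∧ ¬ G.Adj v u := fun u hu => by simpa using h1 hu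
      refine (gProd_insert G g hg v S (fun h => hv (h3 v h).1) ?_).symm
      intro a ha b hb hab
      rw [Finset.mem_insert] at ha hb
      rcases ha with rfl | ha <;> rcases hb with rfl | hb
      · exact absurd rfl hab
      · exact (h3 b hb).2
      · exact fun h => (h3 a ha).2 h.symm
      · exact h2 a ha b hb hab

/-- The part of the independent sum that meets the neighbourhood of `v`. -/
theorem indepSum_sub {V : Type*} [LinearOrder V] {R : Type*} [Ring R] (G : SimpleGraph V)
    (g : V → R) (v : V) (s : Finset V) :
    indepSum G g s = indepSum G g (s.filter (fun u => ¬ G.Adj v u)) +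
      ∑ S ∈ s.powerset.filter (fun S => IsIndep G S ∧ ∃ k ∈ S, G.Adj v k), gProd g S := by
  unfold indepSum
  rw [← Finset.sum_filter_add_sum_filter_not _ (fun S => ∀ k ∈ S, ¬ G.Adj v k)]
  congr 1
  · apply Finset.sum_congr _ (fun _ _ => rfl)
    ext S
    simp only [Finset.mem_filter, Finset.mem_powerset, Finset.subset_iff]
    grind
  · apply Finset.sum_congr _ (fun _ _ => rfl)
    ext S
    simp only [Finset.mem_filter, Finset.mem_powerset, Finset.subset_iff]
    grind

theorem gProd_K {V : Type*} [LinearOrder V] {R : Type*} [Ring R] (G : SimpleGraph V)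
    (g : V → R) (hg : ∀ u w, u ≠ w → ¬ G.Adj u w → g u * g w = g w * g u)
    (v : V) (s : Finset V)
    (hK : ∀ a ∈ s, ∀ b ∈ s, G.Adj v a → G.Adj v b → a ≠ b → G.Adj a b)
    (S : Finset V)
    (hS : S ∈ s.powerset.filter (fun S => IsIndep G S ∧ ∃ k ∈ S, G.Adj v k)) :
    ∃ k ∈ s, G.Adj v k ∧ gProd g S = g k * gProd g (S.erase k) ∧
      (∀ u ∈ S.erase k, u ∈ s ∧ ¬ G.Adj v u) ∧ k ∈ S ∧ IsIndep G S := by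
  simp only [Finset.mem_filter, Finset.mem_powerset] at hS
  obtain ⟨h1, h2, k, hk, hvk⟩ := hS
  refine ⟨k, h1 hk, hvk, ?_, ?_, hk, h2⟩
  · have := gProd_insert G g hg k (S.erase k) (by simp) (by rwa [Finset.insert_erase hk])
    rwa [Finset.insert_erase hk] at this
  · intro u hu
    rw [Finset.mem_erase] at hu
    exact ⟨h1 hu.2, fun h => h2 u hu.2 k hk hu.1 (hK u (h1 hu.2) k (h1 hk) h hvk hu.1)⟩

theorem indepSum_congr {V : Type*} [LinearOrder V] {R : Type*} [Ring R] (G : SimpleGraph V)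
    (g g' : V → R) (s : Finset V) (h : ∀ u ∈ s, g u = g' u) :
    indepSum G g s = indepSum G g' s := by
  unfold indepSum
  apply Finset.sum_congr rfl
  intro S hS
  simp only [Finset.mem_filter, Finset.mem_powerset] at hS
  exact gProd_congr _ _ _ (fun u hu => h u (hS.1 hu))

theorem indepSum_scale {V : Type*} [LinearOrder V] {R : Type*} [Ring R] [Algebra ℂ R]
    (G : SimpleGraph V)
    (g : V → R) (hg : ∀ u w, u ≠ w → ¬ G.Adj u w → g u * g w = g w * g u)
    (v : V) (s : Finset V)
    (hK : ∀ a ∈ s, ∀ b ∈ s, G.Adj v a → G.Adj v b → a ≠ b → G.Adj a b) (t : ℂ) :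
    indepSum G (fun u => if G.Adj v u then t • g u else g u) s =
      indepSum G g (s.filter (fun u => ¬ G.Adj v u)) +
      t • (indepSum G g s - indepSum G g (s.filter (fun u => ¬ G.Adj v u))) := by
  rw [indepSum_sub G _ v s, indepSum_sub G g v s, add_sub_cancel_left, Finset.smul_sum]
  congr 1
  · apply indepSum_congr
    intro u hu
    simp only [Finset.mem_filter] at hu
    simp [hu.2]
  · apply Finset.sum_congr rfl
    intro S hS
    obtain ⟨k, hks, hvk, h1, h2, hkS, hI⟩ := gProd_K G g hg v s hK S hS
    have hg' : ∀ u w, u ≠ w → ¬ G.Adj u w →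
        (fun u => if G.Adj v u then t • g u else g u) u *
          (fun u => if G.Adj v u then t • g u else g u) w =
        (fun u => if G.Adj v u then t • g u else g u) w *
          (fun u => if G.Adj v u then t • g u else g u) u := by
      intro u w huw hn
      have := hg u w huw hn
      dsimp only
      split_ifs <;> simp [this]
    have h3 := gProd_insert G _ hg' k (S.erase k) (by simp) (by rwa [Finset.insert_erase hkS])
    rw [Finset.insert_erase hkS] at h3
    rw [h3, h1, if_pos hvk, smul_mul_assoc]
    congr 2
    apply gProd_congr
    intro u hu
    simp [(h2 u hu).2]

theorem indepSum_comm {V : Type*} [LinearOrder V] {R : Type*} [Ring R]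
    (G : SimpleGraph V) (g : V → R) (y : R) (s : Finset V)
    (h : ∀ u ∈ s, g u * y = y * g u) :
    indepSum G g s * y = y * indepSum G g s := by
  unfold indepSum
  rw [Finset.sum_mul, Finset.mul_sum]
  apply Finset.sum_congr rfl
  intro S hS
  simp only [Finset.mem_filter, Finset.mem_powerset] at hS
  exact gProd_commute _ _ _ (fun u hu => h u (hS.1 hu))

theorem indepSum_qcomm {V : Type*} [LinearOrder V] {R : Type*} [Ring R] [Algebra ℂ R]
    (G : SimpleGraph V)
    (g : V → R) (hg : ∀ u w, u ≠ w → ¬ G.Adj u w → g u * g w = g w * g u)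
    (v : V) (s : Finset V)
    (hK : ∀ a ∈ s, ∀ b ∈ s, G.Adj v a → G.Adj v b → a ≠ b → G.Adj a b) (y : R) (q : ℂ)
    (h0 : ∀ u ∈ s, ¬ G.Adj v u → g u * y = y * g u)
    (h1 : ∀ u ∈ s, G.Adj v u → g u * y = q • (y * g u)) :
    (indepSum G g s - indepSum G g (s.filter (fun u => ¬ G.Adj v u))) * y =
      q • (y * (indepSum G g s - indepSum G g (s.filter (fun u => ¬ G.Adj v u)))) := by
  rw [indepSum_sub G g v s, add_sub_cancel_left, Finset.sum_mul, Finset.mul_sum, Finset.smul_sum]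
  apply Finset.sum_congr rfl
  intro S hS
  obtain ⟨k, hks, hvk, h2, h3, -, -⟩ := gProd_K G g hg v s hK S hS
  rw [h2, mul_assoc, gProd_commute g y _ (fun u hu => h0 u (h3 u hu).1 (h3 u hu).2),
    ← mul_assoc, h1 k hks hvk, smul_mul_assoc, mul_assoc]

/-- Sum of the words of length `n` in the letters `C`, `D` with `j` letters `D`. -/
def wordSum {R : Type*} [Ring R] (C D : ℕ → R) : ℕ → ℕ → R
  | 0, 0 => 1
  | 0, _ + 1 => 0
  | n + 1, 0 => wordSum C D n 0 * C n
  | n + 1, j + 1 => wordSum C D n (j + 1) * C n + wordSum C D n j * D n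

theorem wordSum_eq_zero {R : Type*} [Ring R] (C D : ℕ → R) :
    ∀ n j, n < j → wordSum C D n j = 0
  | 0, 0, h => absurd h (by simp)
  | 0, _ + 1, _ => rfl
  | n + 1, 0, h => absurd h (by simp)
  | n + 1, j + 1, h => by
    rw [wordSum, wordSum_eq_zero C D n (j + 1) (by omega), wordSum_eq_zero C D n j (by omega)]
    simp

theorem wordSum_qcomm {R : Type*} [Ring R] [Algebra ℂ R] (C D : ℕ → R) (y : R) (q : ℂ)
    (hC : ∀ n, C n * y = y * C n) (hD : ∀ n, D n * y = q • (y * D n)) :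
    ∀ n j, wordSum C D n j * y = q ^ j • (y * wordSum C D n j)
  | 0, 0 => by simp [wordSum]
  | 0, _ + 1 => by simp [wordSum]
  | n + 1, 0 => by
    have := wordSum_qcomm C D y q hC hD n 0
    rw [wordSum, mul_assoc, hC, ← mul_assoc, this]
    simp [mul_assoc]
  | n + 1, j + 1 => by
    have h1 := wordSum_qcomm C D y q hC hD n (j + 1)
    have h2 := wordSum_qcomm C D y q hC hD n j
    rw [wordSum, add_mul, mul_assoc, hC, ← mul_assoc, h1, mul_assoc _ (D n), hD,
      mul_smul_comm, ← mul_assoc _ y, h2, mul_add, smul_add, smul_mul_assoc, smul_mul_assoc,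
      smul_smul, ← pow_succ', mul_assoc, mul_assoc]

theorem wordSum_prod {R : Type*} [Ring R] [Algebra ℂ R] (C D : ℕ → R) (t : ℂ) (n : ℕ) :
    ((List.range n).map (fun m => C m + t • D m)).prod =
      ∑ j ∈ Finset.range (n + 1), t ^ j • wordSum C D n j := by
  induction n with
  | zero => simp [wordSum]
  | succ n ih =>
    rw [List.range_succ, List.map_append, List.prod_append, ih, Finset.sum_range_succ' _ (n + 1)]
    simp only [List.map_cons, List.map_nil, List.prod_cons, List.prod_nil, mul_one, wordSum,
      smul_add, Finset.sum_add_distrib, mul_add]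
    have h1 : ∑ j ∈ Finset.range (n + 1), t ^ (j + 1) • (wordSum C D n (j + 1) * C n) +
        t ^ 0 • (wordSum C D n 0 * C n) =
        (∑ j ∈ Finset.range (n + 1), t ^ j • wordSum C D n j) * C n := by
      rw [← Finset.sum_range_succ' (fun j => t ^ j • (wordSum C D n j * C n)),
        Finset.sum_range_succ, wordSum_eq_zero C D n (n + 1) (by omega), Finset.sum_mul]
      simp
    rw [add_right_comm, h1, Finset.sum_mul _ _ (t • D n)]
    congr 1
    apply Finset.sum_congr rfl
    intro j _
    rw [smul_mul_smul_comm, pow_succ]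

/-- The finite product `∏_{i<n} (1 + q^{-i} y)`. -/
def qPoch {R : Type*} [Ring R] [Algebra ℂ R] (q : ℂ) (y : R) (n : ℕ) : R :=
  Polynomial.aeval y (∏ i ∈ Finset.range n, (1 + Polynomial.C (q⁻¹ ^ i) * Polynomial.X))

theorem qPoch_succ {R : Type*} [Ring R] [Algebra ℂ R] (q : ℂ) (y : R) (n : ℕ) :
    qPoch q y (n + 1) = qPoch q y n * (1 + q⁻¹ ^ n • y) := by
  unfold qPoch
  rw [Finset.prod_range_succ, map_mul]
  simp [Algebra.smul_def]

theorem wordSum_qprod {R : Type*} [Ring R] [Algebra ℂ R] (C D : ℕ → R) (y : R) (q : ℂ)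
    (hq : q ≠ 0)
    (hC : ∀ n, C n * y = y * C n) (hD : ∀ n, D n * y = q • (y * D n)) (n : ℕ) :
    ((List.range n).map (fun m => (1 + q⁻¹ ^ m • y) * C m + D m)).prod =
      ∑ j ∈ Finset.range (n + 1), qPoch q y (n - j) * wordSum C D n j := by
  induction n with
  | zero => simp [wordSum, qPoch]
  | succ n ih =>
    rw [List.range_succ, List.map_append, List.prod_append, ih, Finset.sum_range_succ' _ (n + 1)]
    simp only [List.map_cons, List.map_nil, List.prod_cons, List.prod_nil, mul_one, wordSum,
      Finset.sum_add_distrib, mul_add]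
    have h1 : ∑ j ∈ Finset.range (n + 1),
          qPoch q y (n + 1 - (j + 1)) * (wordSum C D n (j + 1) * C n) +
        qPoch q y (n + 1 - 0) * (wordSum C D n 0 * C n) =
        (∑ j ∈ Finset.range (n + 1), qPoch q y (n - j) * wordSum C D n j) *
          ((1 + q⁻¹ ^ n • y) * C n) := by
      rw [← Finset.sum_range_succ' (fun j => qPoch q y (n + 1 - j) * (wordSum C D n j * C n)),
        Finset.sum_range_succ, wordSum_eq_zero C D n (n + 1) (by omega), Finset.sum_mul]
      simp only [zero_mul, mul_zero, add_zero]
      apply Finset.sum_congr rfl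
      intro j hj
      have hj' : j ≤ n := by simpa [Nat.lt_succ_iff] using hj
      rw [Nat.sub_add_comm hj', qPoch_succ, ← mul_assoc _ _ (C n), ← mul_assoc _ _ (C n)]
      congr 1
      rw [mul_assoc, mul_assoc]
      congr 1
      rw [mul_add, mul_smul_comm, wordSum_qcomm C D y q hC hD, smul_smul, add_mul,
        smul_mul_assoc, one_mul, mul_one]
      congr 2
      have : q⁻¹ ^ n = q⁻¹ ^ (n - j) * q⁻¹ ^ j := by rw [← pow_add, Nat.sub_add_cancel hj']
      rw [this, mul_assoc, ← mul_pow, inv_mul_cancel₀ hq, one_pow, mul_one]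
    rw [add_right_comm, h1, Finset.sum_mul _ _ (D n)]
    congr 1
    apply Finset.sum_congr rfl
    intro j _
    rw [Nat.add_sub_add_right, mul_assoc]

theorem prod_range_root_s14 (d : ℕ) (hd : 0 < d) (q : ℂ) (hq : IsPrimitiveRoot q d) :
    ∏ i ∈ Finset.range d, ((1 : Polynomial ℂ) + Polynomial.C (q⁻¹ ^ i) * Polynomial.X) =
      1 - (-Polynomial.X) ^ d := by
  apply Polynomial.funext
  intro z
  have h1 := hq.inv.pow_sub_pow_eq_prod_sub_mul (x := 1) (y := -z) hd
  have h2 : Polynomial.nthRootsFinset d (1 : ℂ) = (Finset.range d).image (fun i => q⁻¹ ^ i) := by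
    symm
    apply Finset.eq_of_subset_of_card_le
    · intro a ha
      simp only [Finset.mem_image] at ha
      obtain ⟨i, -, rfl⟩ := ha
      rw [Polynomial.mem_nthRootsFinset hd, ← pow_mul, mul_comm, pow_mul, hq.inv.pow_eq_one,
        one_pow]
    · rw [Finset.card_image_of_injOn, hq.card_nthRootsFinset, Finset.card_range]
      intro a ha b hb hab
      simp at ha hb
      exact hq.inv.pow_inj ha hb hab
  rw [h2, Finset.prod_image] at h1
  · rw [Polynomial.eval_prod]
    simp only [Polynomial.eval_add, Polynomial.eval_one, Polynomial.eval_mul, Polynomial.eval_C,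
      Polynomial.eval_X, Polynomial.eval_sub, Polynomial.eval_pow, Polynomial.eval_neg]
    rw [one_pow] at h1
    rw [h1]
    apply Finset.prod_congr rfl
    intros; ring
  · intro a ha b hb hab
    simp at ha hb
    exact hq.inv.pow_inj ha hb hab

theorem qPoch_root {R : Type*} [Ring R] [Algebra ℂ R] (d : ℕ) (hd : 0 < d) (q : ℂ)
    (hq : IsPrimitiveRoot q d) (y : R) : qPoch q y d = 1 - (-y) ^ d := by
  unfold qPoch
  rw [prod_range_root_s14 d hd q hq]
  simp

theorem matrix_coeff_zero {N : ℕ} (n : ℕ) (W : ℕ → Matrix (Fin N) (Fin N) ℂ)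
    (hW : ∀ t : ℂ, ∑ j ∈ Finset.range n, t ^ j • W j = 0) : ∀ j < n, W j = 0 := by
  intro j hj
  ext a b
  have hp : (∑ j ∈ Finset.range n, Polynomial.C (W j a b) * Polynomial.X ^ j) = 0 := by
    apply Polynomial.funext
    intro t
    have := congrFun (congrFun (hW t) a) b
    rw [Matrix.sum_apply] at this
    simp only [Polynomial.eval_finsetSum, Polynomial.eval_mul, Polynomial.eval_C,
      Polynomial.eval_pow, Polynomial.eval_X, Polynomial.eval_zero]
    simpa [mul_comm] using this
  have := congrArg (fun p => Polynomial.coeff p j) hp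
  simpa [Polynomial.finsetSum_coeff, Polynomial.coeff_C_mul, Polynomial.coeff_X_pow, hj] using this

theorem key_alg {N : ℕ} (d : ℕ) (hd : 0 < d) (q : ℂ) (hq : IsPrimitiveRoot q d)
    (C D : ℕ → Matrix (Fin N) (Fin N) ℂ) (y : Matrix (Fin N) (Fin N) ℂ) (w α β : ℂ)
    (hy : y ^ d = w • (1 : Matrix (Fin N) (Fin N) ℂ))
    (hC : ∀ n, C n * y = y * C n) (hD : ∀ n, D n * y = q • (y * D n))
    (hprod : ∀ t : ℂ, ((List.range d).map (fun m => C m + t • D m)).prod =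
      (α + t ^ d * β) • (1 : Matrix (Fin N) (Fin N) ℂ)) :
    ((List.range d).map (fun m => (1 + q⁻¹ ^ m • y) * C m + D m)).prod =
      (α + β + (-(-1) ^ d * w) * α) • (1 : Matrix (Fin N) (Fin N) ℂ) := by
  have hW : ∀ j < d + 1, wordSum C D d j -
      ((if j = 0 then α else 0) + (if j = d then β else 0)) •
        (1 : Matrix (Fin N) (Fin N) ℂ) = 0 := by
    apply matrix_coeff_zero
    intro t
    simp only [smul_sub, Finset.sum_sub_distrib]
    rw [← wordSum_prod, hprod, sub_eq_zero]
    simp only [smul_smul, ← Finset.sum_smul]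
    congr 1
    simp [mul_add, Finset.sum_add_distrib]
  rw [wordSum_qprod C D y q (hq.ne_zero hd.ne') hC hD]
  rw [Finset.sum_congr rfl (fun j hj => by rw [sub_eq_zero.1 (hW j (Finset.mem_range.1 hj))])]
  simp only [add_smul, ite_smul, zero_smul, mul_add, mul_ite, mul_zero, mul_smul_comm, mul_one,
    Finset.sum_add_distrib, Finset.sum_ite_eq', Finset.mem_range]
  rw [if_pos (by omega), if_pos (by omega), Nat.sub_zero, Nat.sub_self, qPoch_root d hd q hq,
    neg_pow, hy]
  have : ((-1 : Matrix (Fin N) (Fin N) ℂ) ^ d) = ((-1 : ℂ) ^ d) • 1 := by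
    rw [← neg_one_smul ℂ (1 : Matrix (Fin N) (Fin N) ℂ), smul_pow, one_pow]
  rw [this]
  simp only [qPoch, Finset.range_zero, Finset.prod_empty, map_one, smul_mul_smul_comm, mul_one]
  module

theorem main_prod {V : Type*} [LinearOrder V] {N : ℕ} (d : ℕ) (hd : 0 < d) (q : ℂ)
    (hq : IsPrimitiveRoot q d) (G : SimpleGraph V) (dir : V → V → Prop)
    (hdir : ∀ u v, dir u v → G.Adj u v)
    (hdir' : ∀ u v, G.Adj u v → (dir u v ↔ ¬ dir v u))
    (f : V → ℕ) (hopeo : IsOPEO G dir f) (A : Finset V) :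
    ∀ (h : V → Matrix (Fin N) (Fin N) ℂ) (w : V → ℂ)
      (_ : ∀ u, h u ^ d = w u • (1 : Matrix (Fin N) (Fin N) ℂ))
      (_ : ∀ u w, dir u w → h u * h w = q • (h w * h u))
      (_ : ∀ u w, u ≠ w → ¬ G.Adj u w → h u * h w = h w * h u),
      ((List.range d).map (fun m => indepSum G (fun u => q⁻¹ ^ m • h u) A)).prod =
        indepSum G (fun u => -(-1) ^ d * w u) A • (1 : Matrix (Fin N) (Fin N) ℂ) := by
  induction A using Finset.induction_on_max_value f with
  | empty =>
    intro h w _ _ _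
    have h1 : ∀ g : V → Matrix (Fin N) (Fin N) ℂ, indepSum G g ∅ = 1 := by
      intro g
      unfold indepSum
      rw [Finset.powerset_empty, Finset.filter_true_of_mem (by simp [IsIndep])]
      simp [gProd]
    have h2 : ∀ g : V → ℂ, indepSum G g ∅ = 1 := by
      intro g
      unfold indepSum
      rw [Finset.powerset_empty, Finset.filter_true_of_mem (by simp [IsIndep])]
      simp [gProd]
    simp [h1, h2]
  | insert v s hv hmax ih =>
    intro h w hpow hcd hcn
    obtain ⟨hinj, hcl, hfwd⟩ := hopeo
    have hlt : ∀ u ∈ s, f u < f v := fun u hu =>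
      lt_of_le_of_ne (hmax u hu) (fun e => hv (hinj e ▸ hu))
    have hK : ∀ a ∈ s, ∀ b ∈ s, G.Adj v a → G.Adj v b → a ≠ b → G.Adj a b :=
      fun a ha b hb h1 h2 hab => hcl v a b h1.symm h2.symm (hlt a ha) (hlt b hb) hab
    have hdv : ∀ u ∈ s, G.Adj v u → dir u v := by
      intro u hu huv
      by_contra hc
      have := (hdir' v u huv).2 hc
      exact absurd (hfwd _ _ this) (not_lt.2 (hlt u hu).le)
    have hgm : ∀ m : ℕ, ∀ u w, u ≠ w → ¬ G.Adj u w →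
        (q⁻¹ ^ m • h u) * (q⁻¹ ^ m • h w) = (q⁻¹ ^ m • h w) * (q⁻¹ ^ m • h u) := by
      intro m u w huw hn
      simp [hcn u w huw hn]
    have hwc : ∀ u u', u ≠ u' → ¬ G.Adj u u' →
        (-(-1) ^ d * w u) * (-(-1) ^ d * w u') = (-(-1) ^ d * w u') * (-(-1) ^ d * w u) :=
      fun _ _ _ _ => mul_comm _ _
    have key := key_alg d hd q hq
      (fun m => indepSum G (fun u => q⁻¹ ^ m • h u) (s.filter (fun u => ¬ G.Adj v u)))
      (fun m => indepSum G (fun u => q⁻¹ ^ m • h u) s -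
        indepSum G (fun u => q⁻¹ ^ m • h u) (s.filter (fun u => ¬ G.Adj v u)))
      (h v) (w v)
      (indepSum G (fun u => -(-1) ^ d * w u) (s.filter (fun u => ¬ G.Adj v u)))
      (indepSum G (fun u => -(-1) ^ d * w u) s -
        indepSum G (fun u => -(-1) ^ d * w u) (s.filter (fun u => ¬ G.Adj v u)))
      (hpow v) ?_ ?_ ?_
    · rw [indepSum_insert G _ hwc v s hv]
      rw [show ∀ a b c : ℂ, a + (b - a) + c * a = b + c * a by intros; ring] at key
      rw [← key]
      congr 2
      funext m
      rw [indepSum_insert G _ (hgm m) v s hv, add_mul, one_mul]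
      abel
    · intro m
      apply indepSum_comm
      intro u hu
      rw [Finset.mem_filter] at hu
      rw [smul_mul_assoc, mul_smul_comm, hcn u v (fun e => hv (e ▸ hu.1)) (fun e => hu.2 e.symm)]
    · intro m
      apply indepSum_qcomm G _ (hgm m) v s hK
      · intro u hu hn
        rw [smul_mul_assoc, mul_smul_comm, hcn u v (fun e => hv (e ▸ hu)) (fun e => hn e.symm)]
      · intro u hu hn
        rw [smul_mul_assoc, mul_smul_comm, hcd u v (hdv u hu hn), smul_comm]
    · intro t
      have := ih (fun u => if G.Adj v u then t • h u else h u)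
        (fun u => if G.Adj v u then t ^ d * w u else w u) ?_ ?_ ?_
      · have e1 := indepSum_scale G _ hwc v s hK (t ^ d)
        rw [smul_eq_mul] at e1
        rw [← e1]
        convert this using 2
        · congr 1
          funext m
          rw [← indepSum_scale G _ (hgm m) v s hK t]
          congr 1
          funext u
          split_ifs
          · rw [smul_comm]
          · rfl
        · congr 1
          funext u
          split_ifs
          · rw [smul_eq_mul]; ring
          · rfl
      · intro u
        split_ifs
        · rw [smul_pow, hpow, smul_smul]
        · exact hpow u
      · intro a b hab
        have := hcd a b hab
        split_ifs <;> simp [this, smul_smul, mul_comm, mul_left_comm]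
      · intro a b hab hn
        have := hcn a b hab hn
        split_ifs <;> simp [this, smul_smul, mul_comm]

theorem transferT_eq_s14 {V : Type*} [LinearOrder V] {N : ℕ} (G : SimpleGraph V)
    (h : V → Matrix (Fin N) (Fin N) ℂ) (A : Finset V) (x : ℂ) :
    transferT G h A x = indepSum G (fun u => (-x) • h u) A := by
  unfold transferT indepSum chargeQ
  rw [← Finset.sum_fiberwise_of_maps_to (s := A.powerset.filter (fun S => IsIndep G S))
    (t := Finset.range (indepNum G A + 1)) (g := Finset.card)]
  · apply Finset.sum_congr rfl
    intro k _
    rw [Finset.smul_sum, Finset.filter_filter]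
    apply Finset.sum_congr rfl
    intro S hS
    rw [Finset.mem_filter] at hS
    rw [gProd_smul, hS.2.2]
    rfl
  · intro S hS
    rw [Finset.mem_range, Nat.lt_succ_iff]
    exact Finset.le_sup (f := Finset.card) hS

theorem indepPoly_eq {V : Type*} [LinearOrder V] (G : SimpleGraph V)
    (w : V → ℂ) (A : Finset V) (x : ℂ) :
    indepPoly G w A x = indepSum G (fun u => x * w u) A := by
  unfold indepPoly indepSum
  apply Finset.sum_congr rfl
  intro S _
  unfold gProd
  rw [← List.prod_toFinset _ (Finset.sort_nodup _ _), Finset.sort_toFinset]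

/-- relation between a simplicial mode and a parafermionic mode. -/
theorem simplicial_paraMode_relation
    {V : Type*} [Fintype V] [LinearOrder V] {N : ℕ}
    (d : ℕ) (hd : 2 ≤ d)
    (G : SimpleGraph V) (dir : V → V → Prop)
    (hdir : ∀ u v, dir u v → G.Adj u v)
    (hdir' : ∀ u v, G.Adj u v → (dir u v ↔ ¬ dir v u))
    (hdip : DipathOriented G dir)
    (f : V → ℕ) (hopeo : IsOPEO G dir f)
    (v : V) (hlast : ∀ u, u ≠ v → f u < f v)
    (h : V → Matrix (Fin N) (Fin N) ℂ) (b : V → ℝ)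
    (hb : ∀ w, b w ≠ 0)
    (hpow : ∀ w, h w ^ d = ((b w : ℂ) ^ d) • (1 : Matrix (Fin N) (Fin N) ℂ))
    (hcd : ∀ u w, dir u w → h u * h w = omegaD d • (h w * h u))
    (hcn : ∀ u w, u ≠ w → ¬ G.Adj u w → h u * h w = h w * h u)
    (χ : Matrix (Fin N) (Fin N) ℂ) (hχ : IsUnit χ)
    (hχcomm : ∀ u, u ≠ v → χ * h u = h u * χ)
    (hχv : h v * χ = omegaD d • (χ * h v))
    (εl : ℂ) (hε : εl ≠ 0)
    (hZ : indepPoly G (fun w => (b w : ℂ) ^ d) Finset.univ (-(εl ^ (-(d : ℤ)))) = 0)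
    (Nl : ℂ) (hN : Nl ≠ 0) :
    ∀ q : ℤ,
      (1 + omegaD d) • (χ * paraMode d G h χ εl Nl q) =
        Nl⁻¹ • (transferT G h Finset.univ (εl⁻¹ * omegaD d ^ (-q)) * (χ * χ) *
          transferTsucc d G h Finset.univ q εl⁻¹) := by
  intro q
  have hd0 : 0 < d := by omega
  have hω : IsPrimitiveRoot (omegaD d) d := Complex.isPrimitiveRoot_exp d hd0.ne'
  have hω0 : omegaD d ≠ 0 := hω.ne_zero hd0.ne'
  set x : ℂ := εl⁻¹ * omegaD d ^ (-q) with hx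
  have hxd : x ^ d = εl ^ (-(d : ℤ)) := by
    rw [hx, mul_pow, ← zpow_natCast (omegaD d ^ (-q)), ← zpow_mul, mul_comm (-q), zpow_mul,
      zpow_natCast, hω.pow_eq_one, one_zpow, mul_one, zpow_neg, zpow_natCast, inv_pow]
  -- the full product of transfer operators vanishes
  have hfull : transferT G h Finset.univ x * transferTsucc d G h Finset.univ q εl⁻¹ = 0 := by
    have hm := main_prod d hd0 (omegaD d) hω G dir hdir hdir' f hopeo Finset.univ
      (fun u => (-x) • h u) (fun u => (-x) ^ d * (b u : ℂ) ^ d)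
      (fun u => by rw [smul_pow, hpow, smul_smul])
      (fun u w huw => by
        rw [smul_mul_smul_comm, smul_mul_smul_comm, hcd u w huw, smul_comm])
      (fun u w huw hn => by
        rw [smul_mul_smul_comm, smul_mul_smul_comm, hcn u w huw hn])
    have hz : indepSum G (fun u => -(-1) ^ d * ((-x) ^ d * (b u : ℂ) ^ d)) Finset.univ = 0 := by
      rw [indepPoly_eq] at hZ
      rw [← hZ]
      congr 1
      funext u
      rw [← hxd, ← mul_assoc, neg_mul, ← mul_pow]
      simp
    rw [hz, zero_smul] at hm
    rw [← hm]
    obtain ⟨e, rfl⟩ : ∃ e, d = e + 1 := ⟨d - 1, by omega⟩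
    rw [List.range_succ_eq_map, List.map_cons, List.prod_cons, List.map_map]
    unfold transferTsucc
    rw [transferT_eq_s14, Nat.add_sub_cancel]
    congr 1
    · congr 1
      funext u
      simp
    · have hl : (do let a ← List.range e; pure (a : ℤ)) =
          (List.range e).map (fun a : ℕ => (a : ℤ)) := List.map_eq_flatMap.symm
      rw [hl, List.map_map]
      congr 2
      funext m
      simp only [Function.comp]
      rw [transferT_eq_s14]
      congr 1
      funext u
      rw [smul_smul]
      congr 1
      have : (-(q + (m : ℤ) + 1)) = -q + -((m.succ : ℕ) : ℤ) := by push_cast; ring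
      rw [this, zpow_add₀ hω0, zpow_neg _ ((m.succ : ℕ) : ℤ), zpow_natCast, hx, inv_pow]
      ring
  -- decomposition of the transfer operator at `v`
  obtain ⟨A, B, hT, hA, hB⟩ : ∃ A B, transferT G h Finset.univ x = A + B ∧ A * χ = χ * A ∧
      B * χ = omegaD d • (χ * B) := by
    have hg : ∀ u w, u ≠ w → ¬ G.Adj u w →
        ((-x) • h u) * ((-x) • h w) = ((-x) • h w) * ((-x) • h u) := by
      intro u w huw hn
      rw [smul_mul_smul_comm, smul_mul_smul_comm, hcn u w huw hn]
    have hins := indepSum_insert G (fun u => (-x) • h u) hg v (Finset.univ.erase v) (by simp)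
    rw [Finset.insert_erase (Finset.mem_univ v)] at hins
    refine ⟨_, _, (transferT_eq_s14 G h _ x).trans hins, ?_, ?_⟩
    · apply indepSum_comm
      intro u hu
      rw [smul_mul_assoc, mul_smul_comm, hχcomm u (Finset.ne_of_mem_erase hu)]
    · rw [mul_assoc, indepSum_comm G _ χ _ (fun u hu => by
        rw [smul_mul_assoc, mul_smul_comm, hχcomm u
          (Finset.ne_of_mem_erase (Finset.mem_filter.1 hu).1)]), ← mul_assoc]
      simp only [smul_mul_assoc, mul_smul_comm]
      rw [hχv, smul_mul_assoc, smul_comm, mul_assoc]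
  unfold paraMode
  rw [← hx]
  rw [mul_smul_comm, smul_comm]
  congr 1
  have hkey : (1 + omegaD d) • (χ * (transferT G h Finset.univ x * χ)) =
      transferT G h Finset.univ x * (χ * χ) +
        omegaD d • (χ * χ * transferT G h Finset.univ x) := by
    rw [hT, ← mul_assoc (A + B), add_mul, hA, hB, add_mul, mul_assoc χ A, hA, smul_mul_assoc,
      mul_assoc χ B, hB]
    simp only [mul_add, mul_smul_comm, mul_assoc]
    module
  rw [← mul_assoc, ← smul_mul_assoc, hkey, add_mul, smul_mul_assoc, mul_assoc (χ * χ), hfull]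
  simp
end
end
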